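/- Under the hypotheses of the Main Theorem (f, g analytic germs at 0 vanishing at 0, ∇f(0) = 0, g − f ∈ (f)^{r+2}, r ≥ 1), define on G = {(ξ,x) : |ξ| < δ, x ∈ U} the vector field X(ξ,x) = ((g−f)(x)/|∇F(ξ,x)|²)·∇F(ξ,x) for x ∉ Z and X(ξ,x) = 0 for x ∈ Z, where Z is the zero set of ∇f and F(ξ,x) = f(x) + ξ(g−f)(x). Then, after possibly shrinking U, there is a constant A' > 0 such that |X(ξ,x)| ≤ A'·dist(x, Z)^{r+1} for all (ξ,x) ∈ G; in particular X is continuous on G. -/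

import Mathlib

open Classical

/-- The full gradient `∇F(ξ,x) = ((g−f)(x), ∇f(x) + ξ∇(g−f)(x))` of
`F(ξ,x) = f(x) + ξ(g−f)(x)`. -/
noncomputable def gradF {n : ℕ} (f g : EuclideanSpace ℝ (Fin n) → ℝ) (ξ : ℝ)
    (x : EuclideanSpace ℝ (Fin n)) : ℝ × EuclideanSpace ℝ (Fin n) :=
  (g x - f x, gradient f x + ξ • gradient (fun y => g y - f y) x)

/-- The Kuiper–Kuo type vector field `X(ξ,x) = ((g−f)(x)/|∇F(ξ,x)|²)·∇F(ξ,x)` for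
`x ∉ Z` and `X(ξ,x) = 0` for `x ∈ Z` (`Z` the zero set of `∇f`). -/
noncomputable def XF {n : ℕ} (f g : EuclideanSpace ℝ (Fin n) → ℝ) (ξ : ℝ)
    (x : EuclideanSpace ℝ (Fin n)) : ℝ × EuclideanSpace ℝ (Fin n) :=
  if gradient f x = 0 then 0 else ((g x - f x) / ‖gradF f g ξ x‖ ^ 2) • gradF f g ξ x

set_option linter.unusedSectionVars false
namespace Arc
section A1
variable {V : Type*} [CommRing V] [IsDomain V] [Algebra ℂ V]

def Rel (π : V) (v : V) (s : PowerSeries ℂ) : Prop :=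
  ∀ n : ℕ, π ^ n ∣ v - Polynomial.aeval π (PowerSeries.trunc n s)

lemma Rel.add {π v w : V} {s t : PowerSeries ℂ} (h : Rel π v s) (h' : Rel π w t) :
    Rel π (v + w) (s + t) := by
  intro n
  have := dvd_add (h n) (h' n)
  rw [map_add, map_add]
  convert this using 1
  ring

lemma Rel.neg {π v : V} {s : PowerSeries ℂ} (h : Rel π v s) : Rel π (-v) (-s) := by
  intro n
  have := (h n).neg_right
  rw [map_neg, map_neg]
  convert this using 1
  ring

lemma Rel.mul {π v w : V} {s t : PowerSeries ℂ} (h : Rel π v s) (h' : Rel π w t) :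
    Rel π (v * w) (s * t) := by
  intro n
  have key : (Polynomial.X : Polynomial ℂ) ^ n ∣
      PowerSeries.trunc n s * PowerSeries.trunc n t - PowerSeries.trunc n (s * t) := by
    rw [Polynomial.X_pow_dvd_iff]
    intro d hd
    rw [Polynomial.coeff_sub, PowerSeries.coeff_trunc, if_pos hd, Polynomial.coeff_mul,
      PowerSeries.coeff_mul, sub_eq_zero]
    refine Finset.sum_congr rfl fun x hx => ?_
    have := Finset.HasAntidiagonal.mem_antidiagonal.1 hx
    rw [PowerSeries.coeff_trunc, PowerSeries.coeff_trunc, if_pos (by omega), if_pos (by omega)]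
  have k2 := map_dvd (Polynomial.aeval (R := ℂ) π) key
  simp only [map_pow, Polynomial.aeval_X, map_sub, map_mul] at k2
  have h1 := (h n).mul_right w
  have h2 := (h' n).mul_left (Polynomial.aeval π (PowerSeries.trunc n s))
  convert dvd_add (dvd_add h1 h2) k2 using 1
  ring

lemma Rel.const (π : V) (c : ℂ) : Rel π (algebraMap ℂ V c) (PowerSeries.C c) := by
  intro n
  rcases n with _ | n
  · simp
  · rw [PowerSeries.trunc_C]; simp

lemma Rel.zero_unique {π : V} (hπ : ¬ IsUnit π) (h0 : π ≠ 0) {s : PowerSeries ℂ}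
    (h : Rel π 0 s) : s = 0 := by
  by_contra hs
  have hex : ∃ k, PowerSeries.coeff k s ≠ 0 := by
    by_contra hc
    push Not at hc
    exact hs (PowerSeries.ext (by simpa using hc))
  set k := Nat.find hex
  have hk : PowerSeries.coeff k s ≠ 0 := Nat.find_spec hex
  have hlt : ∀ j < k, PowerSeries.coeff j s = 0 := fun j hj => by
    simpa using Nat.find_min hex hj
  have ht : PowerSeries.trunc (k+1) s = Polynomial.monomial k (PowerSeries.coeff k s) := by
    ext j
    rw [PowerSeries.coeff_trunc, Polynomial.coeff_monomial]
    split_ifs with h1 h2 h2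
    · rw [h2]
    · exact hlt j (by omega)
    · omega
    · rfl
  have := h (k+1)
  rw [ht, Polynomial.aeval_monomial, zero_sub, dvd_neg, pow_succ, mul_comm (algebraMap _ _ _)] at this
  have h2 := (mul_dvd_mul_iff_left (pow_ne_zero k h0)).1 this
  exact hπ (isUnit_of_dvd_unit h2 ((IsUnit.mk0 _ hk).map (algebraMap ℂ V)))

lemma Rel.unique {π : V} (hπ : ¬ IsUnit π) (h0 : π ≠ 0) {v : V} {s t : PowerSeries ℂ}
    (h : Rel π v s) (h' : Rel π v t) : s = t := by
  have := h.add h'.neg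
  rw [add_neg_cancel] at this
  have := this.zero_unique hπ h0
  exact sub_eq_zero.1 (by rw [sub_eq_add_neg]; exact this)

lemma Rel.exists {π : V} (hres : ∀ v : V, ∃ c : ℂ, ∃ w : V, v = algebraMap ℂ V c + π * w) (v : V) :
    ∃ s, Rel π v s := by
  choose c w hcw using hres
  let it : ℕ → V := fun n => w^[n] v
  refine ⟨PowerSeries.mk fun n => c (it n), fun n => ⟨it n, ?_⟩⟩
  induction n with
  | zero => simp [it]
  | succ n ih =>
    rw [PowerSeries.trunc_succ, map_add, ← sub_sub, ih, Polynomial.aeval_monomial]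
    have h1 : it (n+1) = w (it n) := by simp only [it]; rw [Function.iterate_succ_apply']
    rw [h1, PowerSeries.coeff_mk]
    nth_rewrite 1 [hcw (it n)]
    ring

/-- arcs from a ring with principal maximal ideal and residue field `ℂ`. -/
lemma exists_arc_of_uniformizer {π : V} (hπ : ¬ IsUnit π) (h0 : π ≠ 0)
    (hres : ∀ v : V, ∃ c : ℂ, ∃ w : V, v = algebraMap ℂ V c + π * w)
    (hinf : ∀ v : V, (∀ n, π ^ n ∣ v) → v = 0) :
    ∃ T : V →ₐ[ℂ] PowerSeries ℂ, Function.Injective T := by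
  choose T hT using Rel.exists hres
  have hu := fun {v s} (h : Rel π v s) => Rel.unique hπ h0 (hT v) h
  refine ⟨{ toFun := T
            map_one' := ?_
            map_mul' := ?_
            map_zero' := ?_
            map_add' := ?_
            commutes' := ?_ }, ?_⟩
  · have := hu (Rel.const π 1); simpa using this
  · intro x y; exact hu ((hT x).mul (hT y))
  · have := hu (Rel.const π 0); simpa using this
  · intro x y; exact hu ((hT x).add (hT y))
  · intro c; exact hu (Rel.const π c)
  · rw [injective_iff_map_eq_zero]
    intro v hv
    apply hinf
    intro n
    have := hT v n
    have hv' : T v = 0 := hv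
    simpa [hv'] using this
end A1
end Arc
set_option linter.unusedSectionVars false
namespace Arc

/-- Noetherianity from quotients by principal ideals. -/
lemma noeth_of_quot {R : Type*} [CommRing R]
    (h : ∀ g : R, g ≠ 0 → ∃ g' : R, g' ≠ 0 ∧ g ∣ g' ∧ IsNoetherianRing (R ⧸ Ideal.span {g'})) :
    IsNoetherianRing R := by
  rw [isNoetherianRing_iff_ideal_fg]
  intro I
  by_cases hI : I = ⊥
  · rw [hI]; exact Submodule.fg_bot
  obtain ⟨g, hgI, hg0⟩ := Submodule.exists_mem_ne_zero_of_ne_bot hI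
  obtain ⟨g', hg'0, hd, hN⟩ := h g hg0
  have hg'I : g' ∈ I := I.mem_of_dvd hd hgI
  have h1 : (I.map (Ideal.Quotient.mk (Ideal.span {g'}))).FG := hN.noetherian _
  have h2 : (I ⊓ RingHom.ker (Ideal.Quotient.mk (Ideal.span {g'}))).FG := by
    rw [Ideal.mk_ker, inf_eq_right.2 ((Ideal.span_singleton_le_iff_mem I).2 hg'I)]
    exact ⟨{g'}, by simp⟩
  have := Submodule.fg_of_fg_map_of_fg_inf_ker
    (Submodule.mkQ (Ideal.span {g'} : Ideal R)) (s := I) ?_ ?_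
  · exact this
  · obtain ⟨s, hs⟩ := h1
    have h3 : (Submodule.map (Submodule.mkQ (Ideal.span {g'} : Ideal R)) I) =
       Submodule.span R (s : Set (R ⧸ Ideal.span {g'})) := by
      apply SetLike.coe_injective
      have e1 : ((Ideal.span (s : Set (R ⧸ Ideal.span {g'})) : Ideal _) : Set (R ⧸ Ideal.span {g'})) =
          Submodule.span R (s : Set (R ⧸ Ideal.span {g'})) := by
        ext x
        rw [SetLike.mem_coe, SetLike.mem_coe]
        have := Submodule.restrictScalars_span R (R ⧸ Ideal.span {g'}) Ideal.Quotient.mk_surjective (s : Set (R ⧸ Ideal.span {g'}))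
        rw [← this]; rfl
      rw [← e1, hs]
      ext x
      constructor
      · rintro ⟨y, hy, rfl⟩
        exact Ideal.mem_map_of_mem _ hy
      · intro hx
        obtain ⟨y, hy, rfl⟩ := (Ideal.mem_map_iff_of_surjective _ Ideal.Quotient.mk_surjective).1 hx
        exact ⟨y, hy, rfl⟩
    exact ⟨s, h3.symm⟩
  · rw [Submodule.ker_mkQ, inf_eq_right.2 ((Ideal.span_singleton_le_iff_mem I).2 hg'I)]
    exact ⟨{g'}, by simp⟩

section A2
variable {B V : Type*} [CommRing B] [IsDomain B] [Algebra ℂ B]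
  [CommRing V] [IsDomain V] [Algebra ℂ V]

/-- dimension of `B/(x)` -/
noncomputable def qd (B : Type*) [CommRing B] [Algebra ℂ B] (x : B) : ℕ := Module.finrank ℂ (B ⧸ Ideal.span {x})

lemma qd_mul_le (hfin : ∀ b : B, b ≠ 0 → Module.Finite ℂ (B ⧸ Ideal.span {b})) (x y : B)
    (hx : x ≠ 0) (hy : y ≠ 0) : qd B (x * y) ≤ qd B x + qd B y := by
  have := hfin x hx
  have := hfin y hy
  have := hfin (x * y) (mul_ne_zero hx hy)
  have hle : Ideal.span {x * y} ≤ Ideal.span {x} := by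
    rw [Ideal.span_singleton_le_span_singleton]; exact dvd_mul_right _ _
  let p : (B ⧸ Ideal.span {x * y}) →ₗ[ℂ] (B ⧸ Ideal.span {x}) :=
    (Ideal.Quotient.factorₐ ℂ hle).toLinearMap
  have hp : ∀ b : B, p (Ideal.Quotient.mk _ b) = Ideal.Quotient.mk _ b := fun b => rfl
  -- the map B → B/(xy), b ↦ x b
  let m0 : B →ₗ[ℂ] (B ⧸ Ideal.span {x * y}) :=
    (Ideal.Quotient.mkₐ ℂ (Ideal.span {x * y})).toLinearMap ∘ₗ LinearMap.mulLeft ℂ x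
  have hm0 : ∀ b, m0 b = Ideal.Quotient.mk _ (x * b) := fun b => rfl
  let N : Submodule ℂ B := (Ideal.span {y}).restrictScalars ℂ
  have hN : N ≤ LinearMap.ker m0 := by
    intro b hb
    have hb' : b ∈ Ideal.span {y} := hb
    obtain ⟨c, rfl⟩ := Ideal.mem_span_singleton.1 hb'
    rw [LinearMap.mem_ker, hm0, Ideal.Quotient.eq_zero_iff_mem, Ideal.mem_span_singleton]
    exact ⟨c, by ring⟩
  let m : (B ⧸ N) →ₗ[ℂ] (B ⧸ Ideal.span {x * y}) := N.liftQ m0 hN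
  have hker : LinearMap.ker p ≤ LinearMap.range m := by
    intro z hz
    obtain ⟨b, rfl⟩ := Ideal.Quotient.mk_surjective z
    rw [LinearMap.mem_ker, hp, Ideal.Quotient.eq_zero_iff_mem, Ideal.mem_span_singleton] at hz
    obtain ⟨c, rfl⟩ := hz
    exact ⟨Submodule.Quotient.mk c, rfl⟩
  have hfN : Module.Finite ℂ (B ⧸ N) := hfin y hy
  have h1 := LinearMap.finrank_range_add_finrank_ker p
  have h2 : Module.finrank ℂ (LinearMap.range p) ≤ qd B x := Submodule.finrank_le _
  have h3 : Module.finrank ℂ (LinearMap.ker p) ≤ Module.finrank ℂ (LinearMap.range m) :=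
    Submodule.finrank_mono hker
  have h4 : Module.finrank ℂ (LinearMap.range m) ≤ qd B y := LinearMap.finrank_range_le m
  unfold qd at *
  omega

lemma qd_pow_le (hfin : ∀ b : B, b ≠ 0 → Module.Finite ℂ (B ⧸ Ideal.span {b})) (c b : B)
    (hc : c ≠ 0) (hb : b ≠ 0) (N : ℕ) : qd B (c ^ N * b) ≤ N * qd B c + qd B b := by
  induction N with
  | zero => simp
  | succ n ih =>
    have := qd_mul_le hfin c (c ^ n * b) hc (mul_ne_zero (pow_ne_zero _ hc) hb)
    rw [pow_succ', mul_assoc]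
    have e : (n+1) * qd B c = n * qd B c + qd B c := by ring
    omega

variable (φ : B →ₐ[ℂ] V) (hinj : Function.Injective φ)
  (hfrac : ∀ v : V, ∃ b : B, b ≠ 0 ∧ ∃ b' : B, φ b * v = φ b')

lemma common_denom (hfrac : ∀ v : V, ∃ b : B, b ≠ 0 ∧ ∃ b' : B, φ b * v = φ b') (s : Finset V) :
    ∃ b : B, b ≠ 0 ∧ ∀ v ∈ s, ∃ b' : B, φ b * v = φ b' := by
  induction s using Finset.induction_on with
  | empty => exact ⟨1, one_ne_zero, by simp⟩
  | insert a s ha ih =>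
    obtain ⟨b, hb, h⟩ := ih
    obtain ⟨c, hc, c', h'⟩ := hfrac a
    refine ⟨b * c, mul_ne_zero hb hc, ?_⟩
    intro v hv
    rcases Finset.mem_insert.1 hv with rfl | hv
    · exact ⟨b * c', by rw [map_mul, map_mul, mul_assoc, h']⟩
    · obtain ⟨b', hb'⟩ := h v hv
      exact ⟨c * b', by rw [map_mul, map_mul, ← hb']; ring⟩

lemma card_le (hinj : Function.Injective φ)
    (hfrac : ∀ v : V, ∃ b : B, b ≠ 0 ∧ ∃ b' : B, φ b * v = φ b')
    (hfin : ∀ b : B, b ≠ 0 → Module.Finite ℂ (B ⧸ Ideal.span {b}))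
    (c : B) (hc : c ≠ 0) (s : ℕ) (v : Fin s → V)
    (hv : LinearIndependent ℂ (fun i => Ideal.Quotient.mk (Ideal.span {φ c}) (v i))) :
    s ≤ qd B c := by
  obtain ⟨b, hb, hbv⟩ := common_denom φ hfrac (Finset.univ.image v)
  have hbv' : ∀ i, ∃ b' : B, φ b * v i = φ b' := fun i => hbv _ (by simp)
  choose w hw using hbv'
  have hφc : φ c ≠ 0 := by rwa [Ne, map_eq_zero_iff _ hinj]
  have hφb : φ b ≠ 0 := by rwa [Ne, map_eq_zero_iff _ hinj]
  -- independence step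
  have key : ∀ (l : Fin s → ℂ), φ c ∣ ∑ i, l i • v i → ∀ i, l i = 0 := by
    intro l hl
    rw [Fintype.linearIndependent_iff] at hv
    apply hv
    rw [← Ideal.mem_span_singleton, ← Ideal.Quotient.eq_zero_iff_mem, map_sum] at hl
    rw [← hl]
    refine Finset.sum_congr rfl fun i _ => ?_
    exact (map_smul (Ideal.Quotient.mkₐ ℂ (Ideal.span {φ c})) (l i) (v i)).symm
  have key2 : ∀ (N : ℕ) (l : Fin N → Fin s → ℂ),
      φ c ^ N ∣ ∑ k : Fin N, φ c ^ (k : ℕ) * ∑ i, l k i • v i → ∀ k i, l k i = 0 := by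
    intro N
    induction N with
    | zero => intro l _ k; exact k.elim0
    | succ N ih =>
      intro l hl
      rw [Fin.sum_univ_succ] at hl
      simp only [Fin.val_zero, pow_zero, one_mul, Fin.val_succ] at hl
      have e : ∑ k : Fin N, φ c ^ ((k : ℕ) + 1) * ∑ i, l k.succ i • v i =
          φ c * ∑ k : Fin N, φ c ^ (k : ℕ) * ∑ i, l k.succ i • v i := by
        rw [Finset.mul_sum]; refine Finset.sum_congr rfl fun k _ => ?_; rw [pow_succ']; ring
      rw [e] at hl
      have h0 : ∀ i, l 0 i = 0 := by
        apply key
        have h1 : φ c ∣ φ c ^ (N+1) := dvd_pow_self _ (by omega)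
        exact (dvd_add_left (dvd_mul_right _ _)).1 (h1.trans hl)
      have h1 : ∀ k i, l (Fin.succ k) i = 0 := by
        apply ih (fun k => l k.succ)
        simp only [h0, zero_smul, Finset.sum_const_zero, zero_add, pow_succ'] at hl
        exact (mul_dvd_mul_iff_left hφc).1 hl
      intro k
      refine Fin.cases h0 h1 k
  have key3 : ∀ N, N * s ≤ qd B (c ^ N * b) := by
    intro N
    have hf := hfin (c ^ N * b) (mul_ne_zero (pow_ne_zero _ hc) hb)
    have hli : LinearIndependent ℂ (fun p : Fin N × Fin s =>
        Ideal.Quotient.mk (Ideal.span {c ^ N * b}) (c ^ (p.1 : ℕ) * w p.2)) := by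
      rw [Fintype.linearIndependent_iff]
      intro g hg
      have hg' : c ^ N * b ∣ ∑ p : Fin N × Fin s, g p • (c ^ (p.1 : ℕ) * w p.2) := by
        rw [← Ideal.mem_span_singleton, ← Ideal.Quotient.eq_zero_iff_mem, map_sum, ← hg]
        refine Finset.sum_congr rfl fun i _ => ?_
        exact (map_smul (Ideal.Quotient.mkₐ ℂ (Ideal.span {c ^ N * b})) _ _)
      have h2 := map_dvd φ hg'
      rw [map_sum, map_mul, map_pow] at h2
      have e : ∑ p : Fin N × Fin s, φ (g p • (c ^ (p.1 : ℕ) * w p.2)) =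
         (∑ k : Fin N, φ c ^ (k : ℕ) * ∑ i, g (k, i) • v i) * φ b := by
        rw [Fintype.sum_prod_type, Finset.sum_mul]
        refine Finset.sum_congr rfl fun k _ => ?_
        rw [Finset.mul_sum, Finset.sum_mul]
        refine Finset.sum_congr rfl fun i _ => ?_
        rw [map_smul, map_mul, map_pow, ← hw, Algebra.smul_def, Algebra.smul_def]
        ring
      rw [e] at h2
      have h3 := key2 N (fun k i => g (k, i)) ((mul_dvd_mul_iff_right hφb).1 h2)
      rintro ⟨k, i⟩
      exact h3 k i
    have := hli.fintype_card_le_finrank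
    simpa [qd] using this
  by_contra hlt
  push Not at hlt
  have h1 := key3 (qd B b + 1)
  have h2 := qd_pow_le hfin c b hc hb (qd B b + 1)
  nlinarith

lemma finite_quot (hinj : Function.Injective φ)
    (hfrac : ∀ v : V, ∃ b : B, b ≠ 0 ∧ ∃ b' : B, φ b * v = φ b')
    (hfin : ∀ b : B, b ≠ 0 → Module.Finite ℂ (B ⧸ Ideal.span {b}))
    (c : B) (hc : c ≠ 0) : Module.Finite ℂ (V ⧸ Ideal.span {φ c}) := by
  have : Module.rank ℂ (V ⧸ Ideal.span {φ c}) ≤ (qd B c : ℕ) := by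
    apply rank_le
    intro s hs
    have e := s.equivFin
    have hs' := hs.comp e.symm e.symm.injective
    choose v hv using fun i => Ideal.Quotient.mk_surjective (I := Ideal.span {φ c}) ((e.symm i : V ⧸ Ideal.span {φ c}))
    apply card_le φ hinj hfrac hfin c hc s.card v
    convert hs' using 2 with i
    exact hv i
  rw [← Module.rank_lt_aleph0_iff]
  exact this.trans_lt (Cardinal.natCast_lt_aleph0)

lemma exists_arc_of_valuationRing [ValuationRing V] (hinj : Function.Injective φ)
    (hfrac : ∀ v : V, ∃ b : B, b ≠ 0 ∧ ∃ b' : B, φ b * v = φ b')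
    (hfin : ∀ b : B, b ≠ 0 → Module.Finite ℂ (B ⧸ Ideal.span {b}))
    (f : B) (hf0 : f ≠ 0) (hfu : ¬ IsUnit (φ f)) :
    ∃ T : V →ₐ[ℂ] PowerSeries ℂ, Function.Injective T := by
  have hnoeth : IsNoetherianRing V := by
    apply noeth_of_quot
    intro g hg
    obtain ⟨b, hb, b', h⟩ := hfrac g
    have hb' : b' ≠ 0 := by
      rintro rfl
      rw [map_zero, mul_eq_zero, map_eq_zero_iff _ hinj] at h
      tauto
    refine ⟨φ b', by rwa [Ne, map_eq_zero_iff _ hinj], ⟨φ b, by rw [← h]; ring⟩, ?_⟩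
    have := finite_quot φ hinj hfrac hfin b' hb'
    exact isNoetherian_of_tower ℂ inferInstance
  have hpid : IsPrincipalIdealRing V := inferInstance
  obtain ⟨π, hπ⟩ := (hpid.principal (IsLocalRing.maximalIdeal V)).principal
  have hπ' : IsLocalRing.maximalIdeal V = Ideal.span {π} := hπ
  have hφf : φ f ≠ 0 := by rwa [Ne, map_eq_zero_iff _ hinj]
  have hfm : φ f ∈ IsLocalRing.maximalIdeal V := by
    rwa [IsLocalRing.mem_maximalIdeal, mem_nonunits_iff]
  have h0 : π ≠ 0 := by
    rintro rfl
    rw [hπ', Ideal.mem_span_singleton, zero_dvd_iff] at hfm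
    exact hφf hfm
  have hπu : ¬ IsUnit π := by
    rw [← mem_nonunits_iff, ← IsLocalRing.mem_maximalIdeal, hπ']
    exact Ideal.mem_span_singleton_self π
  apply exists_arc_of_uniformizer hπu h0
  · intro v
    have := finite_quot φ hinj hfrac hfin f hf0
    have hle : Ideal.span {φ f} ≤ IsLocalRing.maximalIdeal V :=
      (Ideal.span_singleton_le_iff_mem _).2 hfm
    have hfinr : Module.Finite ℂ (V ⧸ IsLocalRing.maximalIdeal V) :=
      Module.Finite.of_surjective (Ideal.Quotient.factorₐ ℂ hle).toLinearMap
        (Ideal.Quotient.factor_surjective hle)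
    have hdom : IsDomain (V ⧸ IsLocalRing.maximalIdeal V) := Ideal.Quotient.isDomain _
    obtain ⟨c, hc⟩ := (IsAlgClosed.algebraMap_bijective_of_isIntegral (k := ℂ)
      (K := V ⧸ IsLocalRing.maximalIdeal V)).2 (Ideal.Quotient.mk _ v)
    have hc' : Ideal.Quotient.mk (IsLocalRing.maximalIdeal V) (algebraMap ℂ V c) = Ideal.Quotient.mk _ v := hc
    rw [Ideal.Quotient.eq, hπ', Ideal.mem_span_singleton] at hc'
    obtain ⟨w, hw⟩ := hc'
    exact ⟨c, -w, by rw [mul_neg, ← hw]; ring⟩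
  · intro v hv
    have := Ideal.iInf_pow_eq_bot_of_isDomain (IsLocalRing.maximalIdeal V) (Ideal.IsPrime.ne_top inferInstance)
    rw [← Ideal.mem_bot, ← this, Ideal.mem_iInf]
    intro n
    rw [hπ', Ideal.span_singleton_pow, Ideal.mem_span_singleton]
    exact hv n
end A2
end Arc
set_option linter.unusedSectionVars false
namespace Arc

lemma height_contra {B : Type*} [CommRing B] [IsDomain B] {p q : Ideal B} [hp : p.IsPrime]
    [hq : q.IsPrime] (h0 : p ≠ ⊥) (hpq : p < q) (hh : q.height ≤ 1) : False := by
  have h1 := Ideal.height_add_one_le_of_lt_of_isPrime hpq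
  have hb : (⊥ : Ideal B) < p := bot_lt_iff_ne_bot.2 h0
  have : (⊥ : Ideal B).IsPrime := Ideal.isPrime_bot
  have h2 := Ideal.height_add_one_le_of_lt_of_isPrime hb
  rw [Ideal.height_bot, zero_add] at h2
  have h3 : (1 : ℕ∞) + 1 ≤ 1 := (add_le_add_left h2 1).trans (h1.trans hh)
  exact absurd h3 (by decide)

lemma prime_eq_max {B : Type*} [CommRing B] [IsDomain B] [IsNoetherianRing B] [IsLocalRing B]
    (f : B) (hfm : f ∈ IsLocalRing.maximalIdeal B) (hf0 : f ≠ 0)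
    (hf : ∀ Q : Ideal B, Q.IsPrime → Q ≠ ⊥ → f ∈ Q) (Q : Ideal B) (hQ : Q.IsPrime) (hQ0 : Q ≠ ⊥) :
    Q = IsLocalRing.maximalIdeal B := by
  by_contra hne
  have hlt : Q < IsLocalRing.maximalIdeal B :=
    lt_of_le_of_ne (IsLocalRing.le_maximalIdeal hQ.ne_top) hne
  have hSfin := Ideal.finite_minimalPrimes_of_isNoetherianRing B (Ideal.span {f})
  by_cases hm : IsLocalRing.maximalIdeal B ∈ (Ideal.span {f}).minimalPrimes
  · exact height_contra hQ0 hlt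
      (Ideal.height_le_one_of_isPrincipal_of_mem_minimalPrimes _ _ hm)
  · have hz : ¬ ((IsLocalRing.maximalIdeal B : Set B) ⊆ ⋃ i ∈ (hSfin.toFinset : Set (Ideal B)), (i : Set B)) := by
      intro hsub
      rw [Ideal.subset_union_prime (f := fun i : Ideal B => i) ⊥ ⊥ (fun i hi _ _ => by
        rw [Set.Finite.mem_toFinset] at hi; exact hi.1.1)] at hsub
      obtain ⟨i, hi, hle⟩ := hsub
      rw [Set.Finite.mem_toFinset] at hi
      have : i = IsLocalRing.maximalIdeal B :=
        le_antisymm (IsLocalRing.le_maximalIdeal hi.1.1.ne_top) hle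
      exact hm (this ▸ hi)
    rw [Set.not_subset] at hz
    obtain ⟨z, hzm, hz⟩ := hz
    simp only [Set.mem_iUnion, not_exists, Finset.mem_coe, Set.Finite.mem_toFinset] at hz
    obtain ⟨Q', hQ', hQ'm⟩ := Ideal.exists_minimalPrimes_le
      ((Ideal.span_singleton_le_iff_mem _).2 hzm)
    have hQp : Q'.IsPrime := hQ'.1.1
    have hzQ : z ∈ Q' := (Ideal.span_singleton_le_iff_mem _).1 hQ'.1.2
    have hQ'h := Ideal.height_le_one_of_isPrincipal_of_mem_minimalPrimes _ _ hQ'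
    have hz0 : z ≠ 0 := by
      rintro rfl
      obtain ⟨p, hp, _⟩ := Ideal.exists_minimalPrimes_le
        ((Ideal.span_singleton_le_iff_mem _).2 hfm)
      exact hz p hp p.zero_mem
    have hQ'0 : Q' ≠ ⊥ := by
      rintro rfl
      exact hz0 hzQ
    obtain ⟨p, hp, hpQ⟩ := Ideal.exists_minimalPrimes_le
      ((Ideal.span_singleton_le_iff_mem _).2 (hf Q' hQp hQ'0))
    have hpp : p.IsPrime := hp.1.1
    have hp0 : p ≠ ⊥ := by
      rintro rfl
      exact hf0 ((Ideal.span_singleton_le_iff_mem _).1 hp.1.2)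
    rcases hpQ.lt_or_eq with h | h
    · exact height_contra hp0 h hQ'h
    · exact hz p hp (h ▸ hzQ)

lemma finite_quot_pow {B : Type*} [CommRing B] [Algebra ℂ B] [IsNoetherianRing B] (m : Ideal B)
    (hres : ∀ b : B, ∃ c : ℂ, b - algebraMap ℂ B c ∈ m) (k : ℕ) :
    ∃ S : Finset B, ∀ b : B, ∃ w ∈ Submodule.span ℂ (S : Set B), b - w ∈ m ^ k := by
  induction k with
  | zero => exact ⟨∅, fun b => ⟨0, by simp, by simp⟩⟩
  | succ k ih =>
    obtain ⟨S, hS⟩ := ih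
    obtain ⟨G, hG⟩ := (isNoetherianRing_iff_ideal_fg B).1 inferInstance (m ^ k)
    have hG' : ∀ x ∈ m ^ k, ∃ w ∈ Submodule.span ℂ (G : Set B), x - w ∈ m ^ (k+1) := by
      intro x hx
      rw [← hG] at hx
      induction hx using Submodule.span_induction with
      | mem x h => exact ⟨x, Submodule.subset_span h, by simp⟩
      | zero => exact ⟨0, by simp, by simp⟩
      | add x y hx hy h1 h2 =>
        obtain ⟨w, hw, hw'⟩ := h1
        obtain ⟨u, hu, hu'⟩ := h2
        refine ⟨w + u, add_mem hw hu, ?_⟩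
        have := add_mem hw' hu'
        convert this using 1; ring
      | smul a x hx h1 =>
        obtain ⟨w, hw, hw'⟩ := h1
        obtain ⟨c, hc⟩ := hres a
        refine ⟨c • w, Submodule.smul_mem _ _ hw, ?_⟩
        have h2 : x ∈ m ^ k := by rw [← hG]; exact hx
        have h3 : (a - algebraMap ℂ B c) * x ∈ m ^ (k+1) := by
          rw [pow_succ']; exact Ideal.mul_mem_mul hc h2
        have h4 := Ideal.mul_mem_left _ (algebraMap ℂ B c) hw'
        convert add_mem h3 h4 using 1
        rw [smul_eq_mul, Algebra.smul_def]; ring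
    refine ⟨S ∪ G, fun b => ?_⟩
    obtain ⟨w, hw, hw'⟩ := hS b
    obtain ⟨u, hu, hu'⟩ := hG' _ hw'
    refine ⟨w + u, ?_, by convert hu' using 1; ring⟩
    rw [Finset.coe_union]
    exact add_mem (Submodule.span_mono Set.subset_union_left hw)
      (Submodule.span_mono Set.subset_union_right hu)

lemma finite_of_pow_le {B : Type*} [CommRing B] [Algebra ℂ B] [IsNoetherianRing B] (m : Ideal B)
    (hres : ∀ b : B, ∃ c : ℂ, b - algebraMap ℂ B c ∈ m) (k : ℕ) (J : Ideal B) (hJ : m ^ k ≤ J) :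
    Module.Finite ℂ (B ⧸ J) := by
  obtain ⟨S, hS⟩ := finite_quot_pow m hres k
  let q := (Ideal.Quotient.mkₐ ℂ J).toLinearMap
  refine ⟨⟨S.image q, ?_⟩⟩
  rw [eq_top_iff]
  rintro z -
  obtain ⟨b, rfl⟩ := Ideal.Quotient.mk_surjective z
  obtain ⟨w, hw, hw'⟩ := hS b
  have : Ideal.Quotient.mk J b = q w := by
    show Ideal.Quotient.mk J b = Ideal.Quotient.mk J w
    rw [Ideal.Quotient.eq]; exact hJ hw'
  rw [this, Finset.coe_image, ← Submodule.map_span]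
  exact Submodule.mem_map_of_mem hw

lemma exists_arc_domain {B : Type*} [CommRing B] [IsDomain B] [IsNoetherianRing B] [IsLocalRing B]
    [Algebra ℂ B] (hres : ∀ b : B, ∃ c : ℂ, b - algebraMap ℂ B c ∈ IsLocalRing.maximalIdeal B)
    (f : B) (hfm : f ∈ IsLocalRing.maximalIdeal B) (hf0 : f ≠ 0)
    (hf : ∀ Q : Ideal B, Q ≠ ⊥ → ∃ k, f ^ k ∈ Q) :
    ∃ T : B →ₐ[ℂ] PowerSeries ℂ, Function.Injective T := by
  have hfin : ∀ b : B, b ≠ 0 → Module.Finite ℂ (B ⧸ Ideal.span {b}) := by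
    intro b hb
    have hrad : IsLocalRing.maximalIdeal B ≤ (Ideal.span {b}).radical := by
      rw [Ideal.radical_eq_sInf]
      refine le_sInf ?_
      rintro Q ⟨hbQ, hQ⟩
      have hQ0 : Q ≠ ⊥ := by
        rintro rfl
        exact hb ((Ideal.span_singleton_le_iff_mem _).1 hbQ)
      rw [prime_eq_max f hfm hf0 (fun Q hQ h0 => ?_) Q hQ hQ0]
      obtain ⟨k, hk⟩ := hf Q h0
      exact hQ.mem_of_pow_mem k hk
    obtain ⟨k, hk⟩ := Ideal.exists_pow_le_of_le_radical_of_fg hrad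
      ((isNoetherianRing_iff_ideal_fg B).1 inferInstance _)
    exact finite_of_pow_le _ hres k _ hk
  let K := FractionRing B
  obtain ⟨A, hA, hloc⟩ := IsLocalRing.exists_factor_valuationRing (algebraMap B K)
  let φ0 : B →+* A := (algebraMap B K).codRestrict A.toSubring hA
  have hφ0 : ∀ b, ((φ0 b : A) : K) = algebraMap B K b := fun b => rfl
  letI : Algebra ℂ A := (φ0.comp (algebraMap ℂ B)).toAlgebra
  let φ : B →ₐ[ℂ] A := { φ0 with commutes' := fun c => rfl }
  have hφ : ∀ b, ((φ b : A) : K) = algebraMap B K b := fun b => rfl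
  have hinj : Function.Injective φ := by
    intro x y hxy
    apply IsFractionRing.injective B K
    rw [← hφ, ← hφ, hxy]
  have hnu : ¬ IsUnit (φ f) := by
    intro hu
    have : IsUnit f := hloc.map_nonunit f hu
    exact (IsLocalRing.mem_maximalIdeal _).1 hfm this
  have hfr : ∀ v : A, ∃ b : B, b ≠ 0 ∧ ∃ a : B, φ b * v = φ a := by
    intro v
    obtain ⟨a, b, hb, hab⟩ := IsFractionRing.div_surjective (A := B) (v : K)
    have hb0 : b ≠ 0 := nonZeroDivisors.ne_zero hb
    refine ⟨b, hb0, a, ?_⟩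
    apply Subtype.ext
    show ((φ b : A) : K) * (v : K) = ((φ a : A) : K)
    rw [hφ, hφ, ← hab, mul_div_cancel₀]
    rwa [Ne, map_eq_zero_iff _ (IsFractionRing.injective B K)]
  obtain ⟨T, hT⟩ := exists_arc_of_valuationRing φ hinj hfr hfin f hf0 hnu
  exact ⟨T.comp φ, hT.comp hinj⟩

/-- Existence of formal arcs. -/
theorem exists_arc {R : Type*} [CommRing R] [IsNoetherianRing R] [IsLocalRing R]
    [Algebra ℂ R] (hres : ∀ b : R, ∃ c : ℂ, b - algebraMap ℂ R c ∈ IsLocalRing.maximalIdeal R)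
    (I : Ideal R) (f : R) (hfm : f ∈ IsLocalRing.maximalIdeal R) (hf : ∀ k, f ^ k ∉ I) :
    ∃ T : R →ₐ[ℂ] PowerSeries ℂ, (∀ x ∈ I, T x = 0) ∧ T f ≠ 0 := by
  have hex : ∃ P : Ideal R, (I ≤ P ∧ ∀ k, f ^ k ∉ P) ∧
      ∀ J : Ideal R, (I ≤ J ∧ ∀ k, f ^ k ∉ J) → ¬ P < J := by
    obtain ⟨P, h1, h2⟩ := set_has_maximal_iff_noetherian.2
      (inferInstance : IsNoetherian R R) {J : Ideal R | I ≤ J ∧ ∀ k, f ^ k ∉ J} ⟨I, le_rfl, hf⟩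
    exact ⟨P, h1, h2⟩
  obtain ⟨P, ⟨hIP, hPf⟩, hmax⟩ := hex
  have hlarge : ∀ J : Ideal R, P < J → ∃ k, f ^ k ∈ J := by
    intro J hJ
    by_contra hc
    push Not at hc
    exact hmax J ⟨hIP.trans hJ.le, hc⟩ hJ
  have hP : P.IsPrime := by
    apply Ideal.isPrime_of_maximally_disjoint P (Submonoid.powers f)
    · rw [Set.disjoint_left]
      rintro x hx ⟨k, rfl⟩
      exact hPf k hx
    · intro J hJ hd
      obtain ⟨k, hk⟩ := hlarge J hJ
      exact Set.disjoint_left.1 hd hk ⟨k, rfl⟩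
  let B := R ⧸ P
  have hBl : IsLocalRing B := IsLocalRing.of_surjective' (Ideal.Quotient.mk P) Ideal.Quotient.mk_surjective
  have hlh : IsLocalHom (Ideal.Quotient.mk P) :=
    IsLocalHom.of_surjective _ Ideal.Quotient.mk_surjective
  have hmem : ∀ x ∈ IsLocalRing.maximalIdeal R, Ideal.Quotient.mk P x ∈ IsLocalRing.maximalIdeal B := by
    intro x hx
    rw [IsLocalRing.mem_maximalIdeal] at hx ⊢
    intro hu
    exact hx (hlh.map_nonunit x hu)
  have hT0 : ∃ T : B →ₐ[ℂ] PowerSeries ℂ, Function.Injective T := by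
    refine exists_arc_domain (B := B) (fun b => ?_) (Ideal.Quotient.mk P f) (hmem f hfm) ?_ ?_
    · obtain ⟨b, rfl⟩ := Ideal.Quotient.mk_surjective b
      obtain ⟨c, hc⟩ := hres b
      exact ⟨c, by have := hmem _ hc; rwa [map_sub] at this⟩
    · intro h
      rw [Ideal.Quotient.eq_zero_iff_mem] at h
      exact hPf 1 (by simpa using h)
    · intro Q hQ
      obtain ⟨q, hq, hq0⟩ := Submodule.exists_mem_ne_zero_of_ne_bot hQ
      have : P < Q.comap (Ideal.Quotient.mk P) := by
        obtain ⟨q, rfl⟩ := Ideal.Quotient.mk_surjective q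
        refine lt_of_le_of_ne (fun x hx => ?_) (fun h => ?_)
        · rw [Ideal.mem_comap, Ideal.Quotient.eq_zero_iff_mem.2 hx]; exact Q.zero_mem
        · have : q ∈ P := by rw [h]; exact hq
          exact hq0 (Ideal.Quotient.eq_zero_iff_mem.2 this)
      obtain ⟨k, hk⟩ := hlarge _ this
      exact ⟨k, by rw [← map_pow]; exact hk⟩
  obtain ⟨T, hT⟩ := hT0
  refine ⟨T.comp (Ideal.Quotient.mkₐ ℂ P), fun x hx => ?_, fun h => ?_⟩
  · show T (Ideal.Quotient.mk P x) = 0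
    rw [Ideal.Quotient.eq_zero_iff_mem.2 (hIP hx), map_zero]
  · have h' : T (Ideal.Quotient.mk P f) = 0 := h
    rw [map_eq_zero_iff _ hT, Ideal.Quotient.eq_zero_iff_mem] at h'
    exact hPf 1 (by simpa using h')
end Arc
set_option linter.unusedSectionVars false
namespace Arc
open Filter Topology Metric

variable {E : Type*} [NormedAddCommGroup E] [NormedSpace ℂ E]

/-- Cauchy estimate. -/
lemma fderiv_bound {f : E → ℂ} {x : E} {R M : ℝ} (hR : 0 < R)
    (hd : DifferentiableOn ℂ f (ball x R)) (hM : ∀ y ∈ ball x R, ‖f y‖ ≤ M) :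
    ‖fderiv ℂ f x‖ ≤ (2 * M) / R := by
  refine Complex.norm_fderiv_le_div_of_mapsTo_ball hd (fun y hy => ?_) hR
  rw [mem_closedBall, dist_eq_norm]
  have h1 := hM y hy
  have h2 := hM x (mem_ball_self hR)
  linarith [norm_sub_le (f y) (f x)]

/-- Uniform limits of holomorphic functions are holomorphic. -/
lemma diff_of_unif {F : ℕ → E → ℂ} {f : E → ℂ} {x : E} {R : ℝ} (hR : 0 < R)
    (hd : ∀ n, DifferentiableOn ℂ (F n) (ball x R))
    (hu : TendstoUniformlyOn F f atTop (ball x R)) : DifferentiableAt ℂ f x := by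
  have hR2 : 0 < R / 2 := by linarith
  have hsub : ∀ y ∈ ball x (R/2), ball y (R/2) ⊆ ball x R := by
    intro y hy
    apply ball_subset_ball'
    rw [mem_ball] at hy; linarith
  have hc : UniformCauchySeqOn (fun n y => fderiv ℂ (F n) y) atTop (ball x (R/2)) := by
    have h0 := hu.uniformCauchySeqOn
    rw [Metric.uniformCauchySeqOn_iff] at h0 ⊢
    intro ε hε
    obtain ⟨N, hN⟩ := h0 (ε * R / 8) (by positivity)
    refine ⟨N, fun m hm n hn y hy => ?_⟩
    have hyR : ball y (R/2) ⊆ ball x R := hsub y hy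
    have hyx : ball x R ∈ 𝓝 y := isOpen_ball.mem_nhds (hyR (mem_ball_self hR2))
    have hb : ‖fderiv ℂ (fun z => F m z - F n z) y‖ ≤ (2 * (ε * R / 8)) / (R / 2) := by
      apply fderiv_bound hR2 (((hd m).sub (hd n)).mono hyR)
      intro z hz
      have := hN m hm n hn z (hyR hz)
      rw [dist_eq_norm] at this
      exact this.le
    rw [fderiv_fun_sub ((hd m).differentiableAt hyx) ((hd n).differentiableAt hyx)] at hb
    rw [dist_eq_norm]
    have : (2 * (ε * R / 8)) / (R / 2) = ε / 2 := by field_simp; norm_num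
    linarith
  have hl : ∀ y ∈ ball x (R/2), ∃ L, Tendsto (fun n => fderiv ℂ (F n) y) atTop (𝓝 L) := by
    intro y hy
    exact cauchySeq_tendsto_of_complete (hc.cauchySeq hy)
  choose! L hL using hl
  have ht := hc.tendstoUniformlyOn_of_tendsto hL
  have := hasFDerivAt_of_tendstoLocallyUniformlyOn (x := x) isOpen_ball ht.tendstoLocallyUniformlyOn
    (fun n y hy => ((hd n).differentiableAt (isOpen_ball.mem_nhds
      (ball_subset_ball (by linarith) hy))).hasFDerivAt)
    (fun y hy => hu.tendsto_at (ball_subset_ball (by linarith) hy)) (mem_ball_self hR2)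
  exact this.differentiableAt

lemma diff_tsum {t : ℕ → E → ℂ} {u : ℕ → ℝ} (hu : Summable u) {x : E} {R : ℝ} (hR : 0 < R)
    (hd : ∀ n, DifferentiableOn ℂ (t n) (ball x R)) (hb : ∀ n, ∀ y ∈ ball x R, ‖t n y‖ ≤ u n) :
    DifferentiableAt ℂ (fun y => ∑' n, t n y) x := by
  refine diff_of_unif hR (F := fun N y => ∑ n ∈ Finset.range N, t n y) (fun N => ?_)
    (tendstoUniformlyOn_tsum_nat hu (fun n y hy => hb n y hy))
  exact DifferentiableOn.fun_sum (fun n _ => hd n)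

/-- second order estimate in one variable -/
lemma quot_est {h : ℂ → ℂ} {ρ M : ℝ} (hρ : 0 < ρ) (hd : DifferentiableOn ℂ h (ball 0 ρ))
    (hM : ∀ z ∈ ball (0:ℂ) ρ, ‖h z‖ ≤ M) {z : ℂ} (hz : z ∈ ball (0:ℂ) ρ) :
    ‖dslope h 0 z‖ ≤ 2 * M / ρ ∧ ‖dslope h 0 z - deriv h 0‖ ≤ (4 * M / ρ) / ρ * ‖z‖ := by
  have h1 : ∀ z ∈ ball (0:ℂ) ρ, ‖dslope h 0 z‖ ≤ 2 * M / ρ := by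
    intro z hz
    refine Complex.norm_dslope_le_div_of_mapsTo_ball hd (fun y hy => ?_) hz
    rw [mem_closedBall, dist_eq_norm]
    have h1 := hM y hy
    have h2 := hM 0 (mem_ball_self hρ)
    linarith [norm_sub_le (h y) (h 0)]
  refine ⟨h1 z hz, ?_⟩
  have hd2 : DifferentiableOn ℂ (dslope h 0) (ball 0 ρ) :=
    (Complex.differentiableOn_dslope (ball_mem_nhds _ hρ)).2 hd
  have := Complex.dist_le_div_mul_dist_of_mapsTo_ball (R₂ := 4 * M / ρ) hd2 (fun y hy => by
    rw [mem_closedBall, dist_eq_norm]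
    have h3 := h1 y hy
    have h2 := h1 0 (mem_ball_self hρ)
    have := norm_sub_le (dslope h 0 y) (dslope h 0 0)
    have e : 4 * M / ρ = 2 * M / ρ + 2 * M / ρ := by ring
    linarith) hz
  simpa [dist_eq_norm, dslope_same] using this

lemma exists_bound {f : E → ℂ} {U : Set E} (hU : IsOpen U) (hf : DifferentiableOn ℂ f U)
    {x : E} (hx : x ∈ U) : ∃ R > 0, ∃ M > 0, ball x R ⊆ U ∧ ∀ y ∈ ball x R, ‖f y‖ ≤ M := by
  have hc : ContinuousAt f x := (hf.differentiableAt (hU.mem_nhds hx)).continuousAt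
  have : ∀ᶠ y in 𝓝 x, ‖f y‖ < ‖f x‖ + 1 :=
    hc.norm.eventually_lt continuousAt_const (by simp)
  obtain ⟨R, hR, h⟩ := Metric.mem_nhds_iff.1 (Filter.inter_mem this (hU.mem_nhds hx))
  exact ⟨R, hR, ‖f x‖ + 1, by positivity, fun y hy => (h hy).2, fun y hy => (h hy).1.le⟩

/-- Directional derivatives of holomorphic functions are holomorphic. -/
lemma diff_dir {f : E → ℂ} {U : Set E} (hU : IsOpen U) (hf : DifferentiableOn ℂ f U) (v : E) :
    DifferentiableOn ℂ (fun x => fderiv ℂ f x v) U := by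
  intro x hx
  obtain ⟨R, hR, M, hM, hRU, hb⟩ := exists_bound hU hf hx
  apply DifferentiableAt.differentiableWithinAt
  set ρ : ℝ := R / 2 / (‖v‖ + 1) with hρ
  have hv1 : 0 < ‖v‖ + 1 := by positivity
  have hρ0 : 0 < ρ := by positivity
  have hmem : ∀ y ∈ ball x (R/2), ∀ z ∈ ball (0:ℂ) ρ, y + z • v ∈ ball x R := by
    intro y hy z hz
    rw [mem_ball, dist_eq_norm] at *
    have h1 : ‖z • v‖ ≤ R / 2 := by
      rw [norm_smul]
      rw [sub_zero] at hz
      calc ‖z‖ * ‖v‖ ≤ ρ * (‖v‖ + 1) := by gcongr; linarith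
        _ = R / 2 := by rw [hρ]; field_simp
    calc ‖y + z • v - x‖ = ‖(y - x) + z • v‖ := by congr 1; abel
      _ ≤ ‖y - x‖ + ‖z • v‖ := norm_add_le _ _
      _ < R := by linarith
  let t : ℕ → ℂ := fun n => ((ρ / (n + 2) : ℝ) : ℂ)
  have ht0 : ∀ n, t n ≠ 0 := fun n => by
    have : (0:ℝ) < ρ / (n + 2) := by positivity
    exact Complex.ofReal_ne_zero.2 (ne_of_gt this)
  have htn : ∀ n : ℕ, ‖t n‖ = ρ / (n + 2) := fun n => by
    have : (0:ℝ) < ρ / (n + 2) := by positivity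
    simp only [t]
    rw [Complex.norm_real, Real.norm_of_nonneg this.le]
  have htb : ∀ n, t n ∈ ball (0:ℂ) ρ := fun n => by
    rw [mem_ball, dist_zero_right, htn, div_lt_iff₀ (by positivity)]
    have : (0:ℝ) ≤ n := by positivity
    nlinarith
  have hlim : Tendsto (fun n => ‖t n‖) atTop (𝓝 0) := by
    simp_rw [htn]
    have h := (tendsto_const_div_atTop_nhds_zero_nat ρ).comp (tendsto_add_atTop_nat 2)
    refine h.congr (fun n => ?_)
    simp
  refine diff_of_unif (R := R/2) (by linarith)
    (F := fun n y => (t n)⁻¹ * (f (y + t n • v) - f y)) (fun n => ?_) ?_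
  · refine DifferentiableOn.const_mul (DifferentiableOn.sub ?_ ?_) _
    · refine hf.comp (by fun_prop) (fun y hy => hRU (hmem y hy _ (htb n)))
    · exact hf.mono ((ball_subset_ball (by linarith)).trans hRU)
  · rw [Metric.tendstoUniformlyOn_iff]
    intro ε hε
    have hev : ∀ᶠ n in atTop, (4 * M / ρ) / ρ * ‖t n‖ < ε := by
      have := hlim.const_mul ((4 * M / ρ) / ρ)
      rw [mul_zero] at this
      exact this.eventually (gt_mem_nhds hε)
    filter_upwards [hev] with n hn y hy
    have hyU : DifferentiableAt ℂ f y := hf.differentiableAt (hU.mem_nhds (hRU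
      (ball_subset_ball (by linarith) hy)))
    let h : ℂ → ℂ := fun z => f (y + z • v)
    have hq := (quot_est (h := h) hρ0 (hf.comp (by fun_prop) (fun z hz => hRU (hmem y hy z hz)))
      (fun z hz => hb _ (hmem y hy z hz)) (htb n)).2
    have hder : deriv h 0 = fderiv ℂ f y v := by
      have h1 : HasFDerivAt f (fderiv ℂ f y) (y + (0:ℂ) • v) := by simpa using hyU.hasFDerivAt
      have h2 : HasDerivAt (fun z : ℂ => y + z • v) v 0 := by
        simpa using ((hasDerivAt_id (0:ℂ)).smul_const v).const_add y
      exact (h1.comp_hasDerivAt (0:ℂ) h2).deriv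
    rw [dslope_of_ne _ (ht0 n), hder, slope_def_field] at hq
    rw [dist_comm, dist_eq_norm]
    refine lt_of_le_of_lt (le_of_eq_of_le ?_ hq) hn
    simp only [h, zero_smul, add_zero, sub_zero]
    congr 2
    rw [div_eq_inv_mul]
end Arc
set_option linter.unusedSectionVars false
namespace Arc
open Filter Topology Metric

variable {F : Type*} [NormedAddCommGroup F] [NormedSpace ℂ F]

/-- Partial difference quotient in the last variable. -/
noncomputable def Q1 (φ : F × ℂ → ℂ) : F × ℂ → ℂ := fun p => dslope (fun z => φ (p.1, z)) 0 p.2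

lemma Q1_eq (φ : F × ℂ → ℂ) (p : F × ℂ) : φ p = φ (p.1, 0) + p.2 * Q1 φ p := by
  have := sub_smul_dslope (fun z => φ (p.1, z)) 0 p.2
  simp only [sub_zero, smul_eq_mul] at this
  rw [Q1, this]; simp

lemma slice_diff {V : Set F} {s : Set ℂ} {φ : F × ℂ → ℂ}
    (hφ : DifferentiableOn ℂ φ (V ×ˢ s)) {y : F} (hy : y ∈ V) :
    DifferentiableOn ℂ (fun z => φ (y, z)) s :=
  hφ.comp (by fun_prop) (fun z hz => ⟨hy, hz⟩)

/-- partial derivative in the last variable -/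
noncomputable def dz (φ : F × ℂ → ℂ) : F × ℂ → ℂ := fun p => fderiv ℂ φ p (0, 1)

lemma slice_deriv {φ : F × ℂ → ℂ} {y : F} {z : ℂ} (hφ : DifferentiableAt ℂ φ (y, z)) :
    HasDerivAt (fun z => φ (y, z)) (dz φ (y, z)) z := by
  have h1 : HasFDerivAt φ (fderiv ℂ φ (y, z)) (y, z) := hφ.hasFDerivAt
  have h2 : HasDerivAt (fun z : ℂ => (y, z)) ((0 : F), (1 : ℂ)) z :=
    (hasDerivAt_const z y).prodMk (hasDerivAt_id z)
  exact h1.comp_hasDerivAt z h2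

lemma dz_iter_diff {U : Set (F × ℂ)} (hU : IsOpen U) {φ : F × ℂ → ℂ} (hφ : DifferentiableOn ℂ φ U)
    (k : ℕ) : DifferentiableOn ℂ (dz^[k] φ) U := by
  induction k with
  | zero => exact hφ
  | succ k ih =>
    rw [Function.iterate_succ_apply']
    exact diff_dir hU ih (0, 1)

lemma iterDeriv_slice {V : Set F} {s : Set ℂ} (hV : IsOpen V) (hs : IsOpen s) {φ : F × ℂ → ℂ}
    (hφ : DifferentiableOn ℂ φ (V ×ˢ s)) {y : F} (hy : y ∈ V) (k : ℕ) :
    ∀ z ∈ s, iteratedDeriv k (fun z => φ (y, z)) z = dz^[k] φ (y, z) := by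
  induction k with
  | zero => intro z hz; simp
  | succ k ih =>
    intro z hz
    rw [iteratedDeriv_succ, Function.iterate_succ_apply']
    have : iteratedDeriv k (fun z => φ (y, z)) =ᶠ[𝓝 z] fun z => dz^[k] φ (y, z) := by
      filter_upwards [hs.mem_nhds hz] with w hw using ih w hw
    rw [this.deriv_eq]
    exact (slice_deriv ((dz_iter_diff (hV.prod hs) hφ k).differentiableAt
      ((hV.prod hs).mem_nhds ⟨hy, hz⟩))).deriv

lemma Q1_taylor {V : Set F} {b M : ℝ} (hV : IsOpen V) (hb : 0 < b) {φ : F × ℂ → ℂ}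
    (hφ : DifferentiableOn ℂ φ (V ×ˢ ball (0:ℂ) b)) (hM : ∀ p ∈ V ×ˢ ball (0:ℂ) b, ‖φ p‖ ≤ M)
    {y : F} (hy : y ∈ V) {z : ℂ} (hz : z ∈ ball (0:ℂ) b) :
    Q1 φ (y, z) = ∑' k : ℕ, ((k+1).factorial : ℂ)⁻¹ * z ^ k * dz^[k+1] φ (y, 0) := by
  have h0 : (0:ℂ) ∈ ball (0:ℂ) b := mem_ball_self hb
  have hit := iterDeriv_slice hV isOpen_ball hφ hy
  by_cases hz0 : z = 0
  · subst hz0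
    rw [tsum_eq_single 0]
    · simp only [Q1, dslope_same]
      have := hit 1 0 h0
      simp only [iteratedDeriv_one] at this
      simp [this]
    · intro k hk; simp [hk]
  · have hs := Complex.hasSum_taylorSeries_on_ball (slice_diff hφ hy) hz
    rw [← hasSum_nat_add_iff' 1] at hs
    have hs2 := hs.mul_left z⁻¹
    rw [Q1, dslope_of_ne _ hz0, slope_def_field]
    refine Eq.trans ?_ (hs2.tsum_eq.symm.trans (tsum_congr fun k => ?_))
    · simp [div_eq_inv_mul]
    · rw [hit _ 0 h0]
      simp only [sub_zero, smul_eq_mul, pow_succ]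
      field_simp

lemma Q1_diff {V : Set F} {b : ℝ} (hV : IsOpen V) (hb : 0 < b) {φ : F × ℂ → ℂ}
    (hφ : DifferentiableOn ℂ φ (V ×ˢ ball (0:ℂ) b)) :
    DifferentiableOn ℂ (Q1 φ) (V ×ˢ ball (0:ℂ) b) := by
  rintro ⟨y, z⟩ ⟨hy, hz⟩
  simp only at hy hz
  apply DifferentiableAt.differentiableWithinAt
  have hO : IsOpen (V ×ˢ ball (0:ℂ) b) := hV.prod isOpen_ball
  by_cases hz0 : z = 0
  · subst hz0
    obtain ⟨R, hR, M, hM, hRU, hbd⟩ := exists_bound hO hφ (x := (y, 0)) ⟨hy, hz⟩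
    have hsub : ball y R ×ˢ ball (0:ℂ) R ⊆ V ×ˢ ball (0:ℂ) b := by
      rw [ball_prod_same]; exact hRU
    have hφ' := hφ.mono hsub
    have hbd' : ∀ p ∈ ball y R ×ˢ ball (0:ℂ) R, ‖φ p‖ ≤ M := by
      rw [ball_prod_same]; exact hbd
    have hev : Q1 φ =ᶠ[𝓝 (y, 0)] fun p => ∑' k : ℕ, ((k+1).factorial : ℂ)⁻¹ * p.2 ^ k *
        dz^[k+1] φ (p.1, 0) := by
      filter_upwards [ball_mem_nhds (y, (0:ℂ)) hR] with p hp
      rw [← ball_prod_same] at hp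
      exact Q1_taylor isOpen_ball hR hφ' hbd' hp.1 hp.2
    refine DifferentiableAt.congr_of_eventuallyEq ?_ hev
    have hR2 : 0 < R / 2 := by linarith
    have hR4 : 0 < R / 4 := by linarith
    refine diff_tsum (u := fun k => M / (R/2) * (1/2)^k) ?_ hR4 ?_ ?_
    · exact (summable_geometric_two).mul_left _
    · intro k
      have h1 : DifferentiableOn ℂ (fun p : F × ℂ => dz^[k+1] φ (p.1, 0)) (ball (y, 0) (R/4)) := by
        refine (dz_iter_diff hO hφ (k+1)).comp (by fun_prop) (fun p hp => ?_)
        rw [← ball_prod_same] at hp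
        exact hsub ⟨ball_subset_ball (by linarith) hp.1, mem_ball_self hR⟩
      exact (by fun_prop : DifferentiableOn ℂ (fun p : F × ℂ => ((k+1).factorial : ℂ)⁻¹ * p.2 ^ k)
        (ball (y, 0) (R/4))).mul h1
    · intro k p hp
      rw [← ball_prod_same] at hp
      have hp1 : p.1 ∈ ball y R := ball_subset_ball (by linarith) hp.1
      have hit := iterDeriv_slice isOpen_ball isOpen_ball hφ' hp1 (k+1) 0 (mem_ball_self hR)
      rw [← hit]
      have hce := Complex.norm_iteratedDeriv_le_of_forall_mem_sphere_norm_le (k+1) hR2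
        (f := fun z => φ (p.1, z)) (c := 0) (C := M)
        (DifferentiableOn.diffContOnCl_ball (U := ball 0 R) (slice_diff hφ' hp1)
          (closedBall_subset_ball (by linarith)))
        (fun z hz => hbd' (p.1, z) ⟨hp1, sphere_subset_closedBall.trans
          (closedBall_subset_ball (by linarith)) hz⟩)
      have hp2 : ‖p.2‖ ≤ R / 4 := by
        have := hp.2
        rw [mem_ball, dist_zero_right] at this
        exact this.le
      have hfac : (0:ℝ) < (k+1).factorial := by exact_mod_cast Nat.factorial_pos _
      rw [norm_mul, norm_mul, norm_inv, norm_pow, Complex.norm_natCast]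
      calc ((k+1).factorial : ℝ)⁻¹ * ‖p.2‖ ^ k * ‖iteratedDeriv (k+1) (fun z => φ (p.1, z)) 0‖
          ≤ ((k+1).factorial : ℝ)⁻¹ * (R/4) ^ k * ((k+1).factorial * M / (R/2) ^ (k+1)) := by
            gcongr
        _ = M / (R/2) * ((R/4)/(R/2)) ^ k := by
            rw [div_pow (R/4), pow_succ]; field_simp
        _ = M / (R/2) * (1/2)^k := by
            congr 2; field_simp; norm_num
  · have hev : Q1 φ =ᶠ[𝓝 (y, z)] fun p => (φ p - φ (p.1, 0)) / p.2 := by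
      have : ∀ᶠ p : F × ℂ in 𝓝 (y, z), p.2 ≠ 0 :=
        continuous_snd.continuousAt.eventually_ne hz0
      filter_upwards [this] with p hp
      rw [Q1, dslope_of_ne _ hp, slope_def_field, sub_zero]
    refine DifferentiableAt.congr_of_eventuallyEq ?_ hev
    have h1 : DifferentiableAt ℂ φ (y, z) := hφ.differentiableAt (hO.mem_nhds ⟨hy, hz⟩)
    have h2 : DifferentiableAt ℂ (fun p : F × ℂ => φ (p.1, 0)) (y, z) := by
      have h3 : DifferentiableAt ℂ φ (y, 0) :=
        hφ.differentiableAt (hO.mem_nhds ⟨hy, mem_ball_self hb⟩)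
      exact DifferentiableAt.comp (f := fun p : F × ℂ => (p.1, (0:ℂ))) (y, z) h3 (by fun_prop)
    simp_rw [div_eq_mul_inv]
    have h4 : DifferentiableAt ℂ (fun p : F × ℂ => p.2⁻¹) (y, z) := by
      have h5 : DifferentiableAt ℂ (fun w : ℂ => w⁻¹) z := differentiableAt_inv hz0
      exact DifferentiableAt.comp (f := fun p : F × ℂ => p.2) (y, z) h5 differentiableAt_snd
    exact (h1.sub h2).mul h4

lemma Q1_bound {V : Set F} {b M : ℝ} (hb : 0 < b) {φ : F × ℂ → ℂ}
    (hφ : DifferentiableOn ℂ φ (V ×ˢ ball (0:ℂ) b)) (hM : ∀ p ∈ V ×ˢ ball (0:ℂ) b, ‖φ p‖ ≤ M) :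
    ∀ p ∈ V ×ˢ ball (0:ℂ) b, ‖Q1 φ p‖ ≤ (2 / b) * M := by
  intro p hp
  have := (quot_est hb (slice_diff hφ hp.1) (fun z hz => hM (p.1, z) ⟨hp.1, hz⟩) hp.2).1
  rw [Q1]; convert this using 1; ring
end Arc
set_option linter.unusedSectionVars false
namespace Arc
open Filter Topology Metric

variable {E : Type*} [NormedAddCommGroup E] [NormedSpace ℂ E]
variable {F : Type*} [NormedAddCommGroup F] [NormedSpace ℂ F]

/-- holomorphic near the origin -/
def HolAt (f : E → ℂ) : Prop := ∀ᶠ x in 𝓝 (0:E), DifferentiableAt ℂ f x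

lemma HolAt.diffAt {f : E → ℂ} (h : HolAt f) : DifferentiableAt ℂ f 0 := h.self_of_nhds
lemma HolAt.contAt {f : E → ℂ} (h : HolAt f) : ContinuousAt f 0 := h.diffAt.continuousAt

lemma holAt_of_diffOn {f : E → ℂ} {U : Set E} (hU : U ∈ 𝓝 (0:E)) (h : DifferentiableOn ℂ f U) :
    HolAt f := by
  filter_upwards [eventually_mem_nhds_iff.2 hU] with x hx
  exact h.differentiableAt hx

lemma HolAt.diffOn {f : E → ℂ} (h : HolAt f) :
    ∃ R > 0, DifferentiableOn ℂ f (ball 0 R) := by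
  obtain ⟨R, hR, h⟩ := Metric.mem_nhds_iff.1 h
  exact ⟨R, hR, fun x hx => (h hx).differentiableWithinAt⟩

lemma HolAt.congr {f g : E → ℂ} (h : HolAt f) (hfg : f =ᶠ[𝓝 0] g) : HolAt g := by
  filter_upwards [h, hfg.eventuallyEq_nhds] with x hx hx2
  exact hx.congr_of_eventuallyEq hx2.symm

lemma holAt_const (c : ℂ) : HolAt (fun _ : E => c) := Eventually.of_forall fun _ => by fun_prop

lemma HolAt.add {f g : E → ℂ} (hf : HolAt f) (hg : HolAt g) : HolAt (f + g) := by
  filter_upwards [hf, hg] with x h1 h2 using h1.add h2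
lemma HolAt.neg {f : E → ℂ} (hf : HolAt f) : HolAt (-f) := by
  filter_upwards [hf] with x h1 using h1.neg
lemma HolAt.mul {f g : E → ℂ} (hf : HolAt f) (hg : HolAt g) : HolAt (f * g) := by
  filter_upwards [hf, hg] with x h1 h2 using h1.mul h2

lemma HolAt.inv {f : E → ℂ} (hf : HolAt f) (h0 : f 0 ≠ 0) : HolAt (fun x => (f x)⁻¹) := by
  filter_upwards [hf, hf.contAt.eventually_ne h0] with x h1 h2
  exact (differentiableAt_inv h2).comp x h1

lemma HolAt.comp {f : E → ℂ} (hf : HolAt f) (L : F →L[ℂ] E) : HolAt (fun x => f (L x)) := by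
  have : Tendsto L (𝓝 0) (𝓝 0) := by simpa using L.continuous.tendsto 0
  filter_upwards [this.eventually hf] with x hx
  exact hx.comp x L.differentiableAt

lemma Q1_iter_eq (φ : F × ℂ → ℂ) (p : F × ℂ) (d : ℕ) :
    φ p = ∑ j ∈ Finset.range d, Q1^[j] φ (p.1, 0) * p.2 ^ j + p.2 ^ d * Q1^[d] φ p := by
  induction d with
  | zero => simp
  | succ d ih =>
    rw [Finset.sum_range_succ, Function.iterate_succ_apply', ih, Q1_eq (Q1^[d] φ) p]
    ring

lemma Q1_iter_diff {V : Set F} {b : ℝ} (hV : IsOpen V) (hb : 0 < b) {φ : F × ℂ → ℂ}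
    (hφ : DifferentiableOn ℂ φ (V ×ˢ ball (0:ℂ) b)) (j : ℕ) :
    DifferentiableOn ℂ (Q1^[j] φ) (V ×ˢ ball (0:ℂ) b) := by
  induction j with
  | zero => exact hφ
  | succ k ih => rw [Function.iterate_succ_apply']; exact Q1_diff hV hb ih

lemma Q1_iter_bound {V : Set F} {b M : ℝ} (hV : IsOpen V) (hb : 0 < b) {φ : F × ℂ → ℂ}
    (hφ : DifferentiableOn ℂ φ (V ×ˢ ball (0:ℂ) b)) (hM : ∀ p ∈ V ×ˢ ball (0:ℂ) b, ‖φ p‖ ≤ M)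
    (j : ℕ) : ∀ p ∈ V ×ˢ ball (0:ℂ) b, ‖Q1^[j] φ p‖ ≤ (2 / b) ^ j * M := by
  induction j with
  | zero => simpa using hM
  | succ k ih =>
    rw [Function.iterate_succ_apply', pow_succ', mul_assoc]
    exact Q1_bound hb (Q1_iter_diff hV hb hφ k) ih

lemma slice0 {V : Set F} {s : Set ℂ} {φ : F × ℂ → ℂ}
    (hφ : DifferentiableOn ℂ φ (V ×ˢ s)) (hs : (0:ℂ) ∈ s) :
    DifferentiableOn ℂ (fun y => φ (y, 0)) V :=
  hφ.comp (by fun_prop) (fun _ hy => ⟨hy, hs⟩)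

lemma exists_order {g : F × ℂ → ℂ} (hg : HolAt g)
    (hne : ¬ ∀ᶠ z in 𝓝 (0:ℂ), g (0, z) = 0) :
    ∃ d, (∀ j < d, Q1^[j] g (0, 0) = 0) ∧ Q1^[d] g (0, 0) ≠ 0 := by
  have hex : ∃ d, Q1^[d] g (0, 0) ≠ 0 := by
    by_contra hc
    push Not at hc
    apply hne
    obtain ⟨R, hR, hd⟩ := hg.diffOn
    obtain ⟨b, hb, M, hM, hbR, hbd⟩ := exists_bound isOpen_ball hd (mem_ball_self hR)
    have hd' := hd.mono hbR
    rw [show (0 : F × ℂ) = (0, 0) from rfl, ← ball_prod_same] at hd' hbd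
    filter_upwards [ball_mem_nhds (0:ℂ) (by linarith : 0 < b / 4)] with z hz
    rw [mem_ball, dist_zero_right] at hz
    have hbound : ∀ k, ‖g (0, z)‖ ≤ M * (1/2) ^ k := by
      intro k
      rw [Q1_iter_eq g (0, z) k, Finset.sum_eq_zero (fun j _ => by simp [hc j]), zero_add, norm_mul,
        norm_pow]
      have := Q1_iter_bound isOpen_ball hb hd' hbd k (0, z)
        ⟨mem_ball_self hb, by rw [mem_ball, dist_zero_right]; linarith⟩
      calc ‖z‖ ^ k * ‖Q1^[k] g (0, z)‖ ≤ (b/4)^k * ((2 / b) ^ k * M) := by gcongr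
        _ = M * ((b/4) * (2/b)) ^ k := by rw [mul_pow]; ring
        _ = M * (1/2) ^ k := by congr 2; field_simp; norm_num
    have hl : Tendsto (fun k : ℕ => M * (1/2 : ℝ) ^ k) atTop (𝓝 (M * 0)) :=
      (tendsto_pow_atTop_nhds_zero_of_lt_one (by norm_num) (by norm_num)).const_mul M
    rw [mul_zero] at hl
    have := ge_of_tendsto' hl hbound
    exact norm_le_zero_iff.1 this
  exact ⟨Nat.find hex, fun j hj => by simpa using Nat.find_min hex hj, Nat.find_spec hex⟩

/-- Weierstrass division. -/
lemma weier_div {g φ : F × ℂ → ℂ} (hg : HolAt g) (hφ : HolAt φ) (d : ℕ)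
    (h1 : ∀ j < d, Q1^[j] g (0, 0) = 0) (h2 : Q1^[d] g (0, 0) ≠ 0) :
    ∃ q : F × ℂ → ℂ, ∃ r : ℕ → F → ℂ, HolAt q ∧ (∀ j, HolAt (r j)) ∧
      ∀ᶠ p in 𝓝 (0 : F × ℂ), φ p = q p * g p + ∑ j ∈ Finset.range d, r j p.1 * p.2 ^ j := by
  obtain ⟨R, hR, hgd⟩ := hg.diffOn
  obtain ⟨R', hR', hφd⟩ := hφ.diffOn
  rw [show (0 : F × ℂ) = (0, 0) from rfl, ← ball_prod_same] at hgd
  set u := Q1^[d] g with hu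
  have hud : DifferentiableOn ℂ u (ball 0 R ×ˢ ball 0 R) := Q1_iter_diff isOpen_ball hR hgd d
  have hball0 : ∀ R : ℝ, 0 < R → ball (0:F) R ×ˢ ball (0:ℂ) R ∈ 𝓝 (0 : F × ℂ) := by
    intro R hR; rw [ball_prod_same]; exact ball_mem_nhds _ hR
  have huH : HolAt u := holAt_of_diffOn (hball0 R hR) hud
  have hv : HolAt (fun p => (u p)⁻¹) := huH.inv h2
  -- common radius
  obtain ⟨R₁, hR₁, hvd⟩ := hv.diffOn
  obtain ⟨b₁, hb₁, C, hC, hbR₁, hvb⟩ := exists_bound isOpen_ball hvd (mem_ball_self hR₁)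
  obtain ⟨b₂, hb₂, M, hM, hbR₂, hφb⟩ := exists_bound isOpen_ball hφd (mem_ball_self hR')
  obtain ⟨b₃, hb₃, hune⟩ := Metric.mem_nhds_iff.1 (huH.contAt.eventually_ne h2)
  obtain ⟨b, hb, hbb⟩ : ∃ b > 0, b ≤ b₁ ∧ b ≤ b₂ ∧ b ≤ b₃ ∧ b ≤ R ∧ b ≤ 1 :=
    ⟨min b₁ (min b₂ (min b₃ (min R 1))), by positivity, by simp, by simp, by simp, by simp, by simp⟩
  obtain ⟨hbb1, hbb2, hbb3, hbbR, hbb4⟩ := hbb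
  -- coefficients
  let c : ℕ → F → ℂ := fun j y => Q1^[j] g (y, 0)
  have hcd : ∀ j, DifferentiableOn ℂ (c j) (ball 0 R) := fun j =>
    slice0 (Q1_iter_diff isOpen_ball hR hgd j) (mem_ball_self hR)
  obtain ⟨ε, hε, hεb⟩ : ∃ ε > 0, C * (d * ε) * (2 / b) ^ d ≤ 1 / 2 := by
    refine ⟨1 / (2 * (C * (d + 1) * (2 / b) ^ d)), by positivity, ?_⟩
    rw [show C * (d * (1 / (2 * (C * (d + 1) * (2 / b) ^ d)))) * (2 / b) ^ d
      = (d / (d + 1)) * (1 / 2) by field_simp]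
    have : (d / (d + 1) : ℝ) ≤ 1 := by rw [div_le_one (by positivity)]; linarith
    linarith
  have hcs : ∀ᶠ y in 𝓝 (0:F), ∀ j ∈ Finset.range d, ‖c j y‖ < ε := by
    rw [Filter.eventually_all_finset]
    intro j hj
    have hc0 : c j 0 = 0 := h1 j (Finset.mem_range.1 hj)
    have : ContinuousAt (c j) 0 :=
      ((hcd j).differentiableAt (ball_mem_nhds _ hR)).continuousAt
    exact this.norm.eventually_lt continuousAt_const (by rw [hc0]; simpa using hε)
  obtain ⟨a₁, ha₁, hcs⟩ := Metric.mem_nhds_iff.1 hcs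
  obtain ⟨a, ha, haa, hab⟩ : ∃ a > 0, a ≤ a₁ ∧ a ≤ b := ⟨min a₁ b, by positivity, by simp, by simp⟩
  set P : Set (F × ℂ) := ball 0 a ×ˢ ball 0 b with hP
  have hPo : IsOpen P := isOpen_ball.prod isOpen_ball
  have hPb : P ⊆ ball 0 b := by
    rw [show (0 : F × ℂ) = (0, 0) from rfl, ← ball_prod_same]
    exact Set.prod_mono (ball_subset_ball hab) le_rfl
  have hP0 : P ∈ 𝓝 (0 : F × ℂ) := prod_mem_nhds (ball_mem_nhds _ ha) (ball_mem_nhds _ hb)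
  let h : F × ℂ → ℂ := fun p => (u p)⁻¹ * ∑ j ∈ Finset.range d, c j p.1 * p.2 ^ j
  have hhd : DifferentiableOn ℂ h P := by
    refine DifferentiableOn.mul (hvd.mono (hPb.trans ((ball_subset_ball hbb1).trans hbR₁))) ?_
    refine DifferentiableOn.fun_sum (fun j _ => DifferentiableOn.mul ?_ (by fun_prop))
    exact (hcd j).comp (by fun_prop) (fun p hp => ball_subset_ball (hab.trans hbbR) hp.1)
  have hhb : ∀ p ∈ P, ‖h p‖ ≤ C * (d * ε) := by
    intro p hp
    simp only [h]
    rw [norm_mul]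
    have hp2 : ‖p.2‖ ≤ 1 := by
      have := hp.2; rw [mem_ball, dist_zero_right] at this; linarith
    have e1 : ‖∑ j ∈ Finset.range d, c j p.1 * p.2 ^ j‖ ≤ d * ε := by
      have := norm_sum_le_of_le (Finset.range d) (f := fun j => c j p.1 * p.2 ^ j)
        (n := fun _ => ε) (fun j hj => by
          rw [norm_mul, norm_pow]
          have := hcs (ball_subset_ball haa hp.1) j hj
          calc ‖c j p.1‖ * ‖p.2‖ ^ j ≤ ε * 1 := by
                gcongr
                exact pow_le_one₀ (norm_nonneg _) hp2
            _ = ε := mul_one _)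
      simpa using this
    gcongr
    exact hvb p (ball_subset_ball hbb1 (hPb hp))
  -- Neumann iteration
  let ψ : ℕ → F × ℂ → ℂ := fun k => (fun ψ p => -(h p) * Q1^[d] ψ p)^[k] φ
  have hψs : ∀ k, ψ (k+1) = fun p => -(h p) * Q1^[d] (ψ k) p := fun k => by
    simp only [ψ]; rw [Function.iterate_succ_apply']
  have hψ : ∀ k, DifferentiableOn ℂ (ψ k) P ∧ ∀ p ∈ P, ‖ψ k p‖ ≤ M * (1/2) ^ k := by
    intro k
    induction k with
    | zero =>
      refine ⟨hφd.mono (hPb.trans ((ball_subset_ball hbb2).trans hbR₂)), fun p hp => ?_⟩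
      simpa [ψ] using hφb p (ball_subset_ball hbb2 (hPb hp))
    | succ k ih =>
      rw [hψs]
      refine ⟨hhd.neg.mul (Q1_iter_diff isOpen_ball hb ih.1 d), fun p hp => ?_⟩
      rw [norm_mul, norm_neg]
      have := Q1_iter_bound isOpen_ball hb ih.1 ih.2 d p hp
      calc ‖h p‖ * ‖Q1^[d] (ψ k) p‖ ≤ (C * (d * ε)) * ((2 / b) ^ d * (M * (1/2) ^ k)) := by
            gcongr
            exact hhb p hp
        _ = (C * (d * ε) * (2 / b) ^ d) * (M * (1/2)^k) := by ring
        _ ≤ (1/2) * (M * (1/2)^k) := by gcongr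
        _ = M * (1/2)^(k+1) := by ring
  have hQd : ∀ j k, DifferentiableOn ℂ (Q1^[j] (ψ k)) P := fun j k =>
    Q1_iter_diff isOpen_ball hb (hψ k).1 j
  have hQb : ∀ j k, ∀ p ∈ P, ‖Q1^[j] (ψ k) p‖ ≤ ((2 / b) ^ j * M) * (1/2) ^ k := fun j k p hp => by
    rw [mul_assoc]; exact Q1_iter_bound isOpen_ball hb (hψ k).1 (hψ k).2 j p hp
  have hsum : ∀ K : ℝ, Summable (fun k : ℕ => K * (1/2 : ℝ) ^ k) := fun K =>
    summable_geometric_two.mul_left K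
  let q' : F × ℂ → ℂ := fun p => ∑' k, Q1^[d] (ψ k) p
  let r : ℕ → F → ℂ := fun j y => ∑' k, Q1^[j] (ψ k) (y, 0)
  have hmem0 : ∀ y ∈ ball (0:F) a, (y, (0:ℂ)) ∈ P := fun y hy => ⟨hy, mem_ball_self hb⟩
  have hq' : HolAt q' := by
    filter_upwards [hPo.mem_nhds (mem_of_mem_nhds hP0)] with x hx
    obtain ⟨ρ, hρ, hρP⟩ := Metric.isOpen_iff.1 hPo x hx
    exact diff_tsum (hsum _) hρ (fun k => (hQd d k).mono hρP) (fun k p hp => hQb d k p (hρP hp))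
  have hr : ∀ j, HolAt (r j) := by
    intro j
    filter_upwards [ball_mem_nhds (0:F) ha] with y hy
    obtain ⟨ρ, hρ, hρP⟩ := Metric.isOpen_iff.1 isOpen_ball y hy
    exact diff_tsum (hsum _) hρ (fun k => (slice0 (hQd j k) (mem_ball_self hb)).mono hρP)
      (fun k p hp => hQb j k _ (hmem0 _ (hρP hp)))
  refine ⟨fun p => q' p * (u p)⁻¹, r, hq'.mul hv, hr, ?_⟩
  filter_upwards [hP0] with p hp
  have hup : u p ≠ 0 := hune (ball_subset_ball hbb3 (hPb hp))
  have hgp : (u p)⁻¹ * g p = p.2 ^ d + h p := by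
    rw [Q1_iter_eq g p d, ← hu]
    simp only [h, c]
    field_simp
    ring
  have hstep : ∀ k, ψ k p - ψ (k+1) p
      = (p.2 ^ d + h p) * Q1^[d] (ψ k) p + ∑ j ∈ Finset.range d, Q1^[j] (ψ k) (p.1, 0) * p.2 ^ j := by
    intro k
    rw [hψs]
    conv_lhs => rw [Q1_iter_eq (ψ k) p d]
    ring
  have hS1 : HasSum (fun k => Q1^[d] (ψ k) p) (q' p) :=
    (Summable.of_norm_bounded (hsum _) (fun k => hQb d k p hp)).hasSum
  have hS2 : ∀ j, HasSum (fun k => Q1^[j] (ψ k) (p.1, 0)) (r j p.1) := fun j =>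
    (Summable.of_norm_bounded (hsum _) (fun k => hQb j k _ (hmem0 _ hp.1))).hasSum
  have hS3 : HasSum (fun k => ψ k p - ψ (k+1) p)
      ((p.2 ^ d + h p) * q' p + ∑ j ∈ Finset.range d, r j p.1 * p.2 ^ j) := by
    simp_rw [hstep]
    exact (hS1.mul_left _).add (hasSum_sum fun j _ => (hS2 j).mul_right _)
  have hψ0 : Tendsto (fun k => ψ k p) atTop (𝓝 0) := by
    rw [tendsto_zero_iff_norm_tendsto_zero]
    refine squeeze_zero (fun _ => norm_nonneg _) (fun k => (hψ k).2 p hp) ?_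
    exact (hsum M).tendsto_atTop_zero
  have hS4 : Tendsto (fun N => ∑ k ∈ Finset.range N, (ψ k p - ψ (k+1) p)) atTop (𝓝 (ψ 0 p - 0)) := by
    simp_rw [Finset.sum_range_sub' (fun k => ψ k p)]
    exact tendsto_const_nhds.sub hψ0
  have := tendsto_nhds_unique hS4 hS3.tendsto_sum_nat
  rw [sub_zero, ← hgp] at this
  show ψ 0 p = _
  rw [this]
  ring
end Arc
set_option linter.unusedSectionVars false
namespace Arc
open Filter Topology Metric

variable {E : Type*} [NormedAddCommGroup E] [NormedSpace ℂ E]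
variable {F : Type*} [NormedAddCommGroup F] [NormedSpace ℂ F]

/-- The ring of germs at the origin of holomorphic functions. -/
def HolS (E : Type*) [NormedAddCommGroup E] [NormedSpace ℂ E] : Subring (Germ (𝓝 (0:E)) ℂ) where
  carrier := {g | ∃ f : E → ℂ, HolAt f ∧ (f : Germ (𝓝 (0:E)) ℂ) = g}
  mul_mem' := by
    rintro _ _ ⟨f, hf, rfl⟩ ⟨g, hg, rfl⟩
    exact ⟨f * g, hf.mul hg, rfl⟩
  one_mem' := ⟨fun _ => 1, holAt_const 1, rfl⟩
  add_mem' := by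
    rintro _ _ ⟨f, hf, rfl⟩ ⟨g, hg, rfl⟩
    exact ⟨f + g, hf.add hg, rfl⟩
  zero_mem' := ⟨fun _ => 0, holAt_const 0, rfl⟩
  neg_mem' := by
    rintro _ ⟨f, hf, rfl⟩
    exact ⟨-f, hf.neg, rfl⟩

/-- The ring of germs at the origin of holomorphic functions. -/
abbrev Hol (E : Type*) [NormedAddCommGroup E] [NormedSpace ℂ E] : Type _ := HolS E

/-- germ of a function -/
def mk (f : E → ℂ) (hf : HolAt f) : Hol E := ⟨(f : Germ (𝓝 (0:E)) ℂ), f, hf, rfl⟩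

lemma mk_surj (g : Hol E) : ∃ f, ∃ hf : HolAt f, g = mk f hf := by
  obtain ⟨_, f, hf, rfl⟩ := g
  exact ⟨f, hf, rfl⟩

lemma mk_eq {f g : E → ℂ} {hf : HolAt f} {hg : HolAt g} : mk f hf = mk g hg ↔ f =ᶠ[𝓝 0] g := by
  exact Subtype.ext_iff.trans Germ.coe_eq

lemma mk_add {f g : E → ℂ} (hf : HolAt f) (hg : HolAt g) :
    mk f hf + mk g hg = mk (f + g) (hf.add hg) := rfl
lemma mk_mul {f g : E → ℂ} (hf : HolAt f) (hg : HolAt g) :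
    mk f hf * mk g hg = mk (f * g) (hf.mul hg) := rfl
lemma mk_neg {f : E → ℂ} (hf : HolAt f) : - mk f hf = mk (-f) hf.neg := rfl
lemma mk_zero : (0 : Hol E) = mk (fun _ => 0) (holAt_const 0) := rfl
lemma mk_one : (1 : Hol E) = mk (fun _ => 1) (holAt_const 1) := rfl

/-- constants -/
def cst (E : Type*) [NormedAddCommGroup E] [NormedSpace ℂ E] : ℂ →+* Hol E where
  toFun c := mk (fun _ => c) (holAt_const c)
  map_one' := rfl
  map_mul' _ _ := rfl
  map_zero' := rfl
  map_add' _ _ := rfl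

noncomputable instance : Algebra ℂ (Hol E) := (cst E).toAlgebra

lemma algMap (c : ℂ) : algebraMap ℂ (Hol E) c = mk (fun _ => c) (holAt_const c) := rfl

/-- Value at the origin. -/
noncomputable def val (E : Type*) [NormedAddCommGroup E] [NormedSpace ℂ E] : Hol E →+* ℂ :=
  (Germ.valueRingHom (X := E) (E := ℂ) (x := 0)).comp (HolS E).subtype

lemma val_mk {f : E → ℂ} (hf : HolAt f) : val E (mk f hf) = f 0 := rfl

lemma isUnit_iff (g : Hol E) : IsUnit g ↔ val E g ≠ 0 := by
  constructor
  · intro h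
    exact (h.map (val E)).ne_zero
  · obtain ⟨f, hf, rfl⟩ := mk_surj g
    intro h0
    rw [val_mk] at h0
    refine IsUnit.of_mul_eq_one (mk _ (hf.inv h0)) ?_
    rw [mk_mul, mk_one, mk_eq]
    filter_upwards [hf.contAt.eventually_ne h0] with x hx
    exact mul_inv_cancel₀ hx

instance : Nontrivial (Hol E) := (val E).domain_nontrivial

instance : IsLocalRing (Hol E) := by
  apply IsLocalRing.of_nonunits_add
  intro a b ha hb
  rw [mem_nonunits_iff, isUnit_iff, not_not] at *
  rw [map_add, ha, hb, add_zero]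

lemma mem_max (g : Hol E) : g ∈ IsLocalRing.maximalIdeal (Hol E) ↔ val E g = 0 := by
  rw [IsLocalRing.mem_maximalIdeal, mem_nonunits_iff, isUnit_iff, not_not]

lemma hol_res (g : Hol E) : ∃ c : ℂ, g - algebraMap ℂ (Hol E) c ∈ IsLocalRing.maximalIdeal (Hol E) := by
  refine ⟨val E g, ?_⟩
  rw [mem_max, map_sub, algMap, val_mk, sub_self]

lemma tend0 (L : F →L[ℂ] E) : Tendsto L (𝓝 0) (𝓝 0) := by simpa using L.continuous.tendsto 0

/-- Pullback by a linear map. -/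
def pull (L : F →L[ℂ] E) : Hol E →+* Hol F where
  toFun g := ⟨Germ.compTendsto g.1 L (tend0 L), by
    obtain ⟨_, f, hf, rfl⟩ := g
    exact ⟨fun x => f (L x), hf.comp L, rfl⟩⟩
  map_one' := rfl
  map_mul' a b := by
    obtain ⟨_, f, hf, rfl⟩ := a
    obtain ⟨_, g, hg, rfl⟩ := b
    rfl
  map_zero' := rfl
  map_add' a b := by
    obtain ⟨_, f, hf, rfl⟩ := a
    obtain ⟨_, g, hg, rfl⟩ := b
    rfl

lemma pull_mk (L : F →L[ℂ] E) {f : E → ℂ} (hf : HolAt f) :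
    pull L (mk f hf) = mk (fun x => f (L x)) (hf.comp L) := rfl

/-- pullback by an isomorphism -/
def pullEquiv (e : F ≃L[ℂ] E) : Hol E ≃+* Hol F :=
  RingEquiv.ofRingHom (pull (e : F →L[ℂ] E)) (pull (e.symm : E →L[ℂ] F))
    (by
      ext g : 1
      obtain ⟨f, hf, rfl⟩ := mk_surj g
      simp [pull_mk])
    (by
      ext g : 1
      obtain ⟨f, hf, rfl⟩ := mk_surj g
      simp [pull_mk])

lemma noeth_of_span {A S : Type*} [CommRing A] [CommRing S] [IsNoetherianRing A] (π : A →+* S)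
    (d : ℕ) (s : ℕ → S) (h : ∀ x : S, ∃ r : ℕ → A, x = ∑ j ∈ Finset.range d, π (r j) * s j) :
    IsNoetherianRing S := by
  letI := π.toAlgebra
  have : Module.Finite A S := by
    refine ⟨⟨(Finset.range d).image s, ?_⟩⟩
    rw [eq_top_iff]
    rintro x -
    obtain ⟨r, rfl⟩ := h x
    refine Submodule.sum_mem _ (fun j hj => ?_)
    exact Submodule.smul_mem _ (r j) (Submodule.subset_span (by
      rw [Finset.coe_image]; exact ⟨j, hj, rfl⟩))
  have h1 : IsNoetherian A S := isNoetherian_of_isNoetherianRing_of_finite A S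
  exact isNoetherian_of_tower A h1

/-- last coordinate -/
noncomputable def zc (F : Type*) [NormedAddCommGroup F] [NormedSpace ℂ F] : Hol (F × ℂ) :=
  mk (fun p => p.2) (Eventually.of_forall fun _ => differentiableAt_snd)

lemma weier_hol {g : F × ℂ → ℂ} (hg : HolAt g) (d : ℕ) (h1 : ∀ j < d, Q1^[j] g (0, 0) = 0)
    (h2 : Q1^[d] g (0, 0) ≠ 0) (φ : Hol (F × ℂ)) : ∃ q : Hol (F × ℂ), ∃ r : ℕ → Hol F,
    φ = q * mk g hg + ∑ j ∈ Finset.range d,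
      pull (ContinuousLinearMap.fst ℂ F ℂ) (r j) * zc F ^ j := by
  obtain ⟨f, hf, rfl⟩ := mk_surj φ
  obtain ⟨q, r, hq, hr, h⟩ := weier_div hg hf d h1 h2
  refine ⟨mk q hq, fun j => mk (r j) (hr j), ?_⟩
  apply Subtype.ext
  have hs : ∀ s : Finset ℕ, ((∑ j ∈ s, pull (ContinuousLinearMap.fst ℂ F ℂ) (mk (r j) (hr j)) * zc F ^ j
      : Hol (F × ℂ)) : Germ (𝓝 (0 : F × ℂ)) ℂ)
      = ((fun p => ∑ j ∈ s, r j p.1 * p.2 ^ j : F × ℂ → ℂ) : Germ (𝓝 (0 : F × ℂ)) ℂ) := by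
    intro s
    induction s using Finset.induction_on with
    | empty => simp; rfl
    | insert i s hi ih =>
      simp_rw [Finset.sum_insert hi]
      push_cast at ih ⊢
      rw [ih]; rfl
  rw [Subring.coe_add, hs]
  exact Germ.coe_eq.2 h

lemma noeth_quot [IsNoetherianRing (Hol F)] {g : F × ℂ → ℂ} (hg : HolAt g)
    (hne : ¬ ∀ᶠ z in 𝓝 (0:ℂ), g (0, z) = 0) :
    IsNoetherianRing (Hol (F × ℂ) ⧸ Ideal.span {mk g hg}) := by
  obtain ⟨d, h1, h2⟩ := exists_order hg hne
  refine noeth_of_span ((Ideal.Quotient.mk _).comp (pull (ContinuousLinearMap.fst ℂ F ℂ))) d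
    (fun j => Ideal.Quotient.mk _ (zc F ^ j)) (fun x => ?_)
  obtain ⟨φ, rfl⟩ := Ideal.Quotient.mk_surjective x
  obtain ⟨q, r, h⟩ := weier_hol hg d h1 h2 φ
  refine ⟨r, ?_⟩
  rw [h, map_add, map_mul, Ideal.Quotient.eq_zero_iff_mem.2 (Ideal.mem_span_singleton_self _),
    mul_zero, zero_add, map_sum]
  simp [map_mul]

lemma exists_dir [Nontrivial E] {g : E → ℂ} (hg : HolAt g) (hne : ¬ g =ᶠ[𝓝 0] (fun _ => 0)) :
    ∃ v : E, v ≠ 0 ∧ ¬ ∀ᶠ t in 𝓝 (0:ℂ), g (t • v) = 0 := by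
  by_contra hc
  push Not at hc
  apply hne
  obtain ⟨R, hR, hd⟩ := hg.diffOn
  filter_upwards [ball_mem_nhds (0:E) hR] with v hv
  by_cases hv0 : v = 0
  · subst hv0
    obtain ⟨w, hw⟩ := exists_ne (0:E)
    simpa using (hc w hw).self_of_nhds
  · have hev := hc v hv0
    rw [mem_ball, dist_zero_right] at hv
    have hnv : 0 < ‖v‖ := norm_pos_iff.2 hv0
    set ρ := R / ‖v‖ with hρ
    have hρ1 : 1 < ρ := by rw [hρ, one_lt_div hnv]; exact hv
    have hda : DifferentiableOn ℂ (fun t : ℂ => g (t • v)) (ball 0 ρ) := by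
      refine hd.comp (by fun_prop) (fun t ht => ?_)
      rw [mem_ball, dist_zero_right] at *
      rw [norm_smul]
      rwa [hρ, lt_div_iff₀ hnv] at ht
    have han := hda.analyticOnNhd isOpen_ball
    have := han.eqOn_zero_of_preconnected_of_eventuallyEq_zero
      (convex_ball (0:ℂ) ρ).isPreconnected (mem_ball_self (by linarith)) hev
    have h1 := this (x := 1) (by rw [mem_ball, dist_zero_right]; simpa using hρ1)
    simpa using h1

/-- **Rückert basis theorem** -/
theorem hol_noeth (n : ℕ) : IsNoetherianRing (Hol (Fin n → ℂ)) := by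
  induction n with
  | zero =>
    apply noeth_of_quot
    intro g hg
    refine ⟨g, hg, dvd_rfl, ?_⟩
    have hu : IsUnit g := by
      rw [isUnit_iff]
      obtain ⟨f, hf, rfl⟩ := mk_surj g
      intro h0
      apply hg
      rw [mk_zero, mk_eq]
      refine Eventually.of_forall (fun x => ?_)
      rw [Subsingleton.elim x 0]; exact h0
    rw [Ideal.span_singleton_eq_top.2 hu]
    infer_instance
  | succ n ih =>
    apply noeth_of_quot
    intro g hg
    refine ⟨g, hg, dvd_rfl, ?_⟩
    obtain ⟨f, hf, rfl⟩ := mk_surj g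
    have hne : ¬ f =ᶠ[𝓝 0] (fun _ => 0) := fun h => hg (by rw [mk_zero, mk_eq]; exact h)
    obtain ⟨v, hv, hnv⟩ := exists_dir hf hne
    have e0 : ((Fin n → ℂ) × ℂ) ≃L[ℂ] (Fin (n+1) → ℂ) :=
      ContinuousLinearEquiv.ofFinrankEq (by simp)
    have hv0 : e0 (0, 1) ≠ 0 := by simp
    obtain ⟨A, hA⟩ := SeparatingDual.exists_continuousLinearEquiv_apply_eq (R := ℂ) hv0 hv
    let e := e0.trans A
    have hev : e (0, 1) = v := hA
    have := noeth_quot (hf.comp (e : ((Fin n → ℂ) × ℂ) →L[ℂ] (Fin (n+1) → ℂ))) (by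
      convert hnv using 4 with t
      have : ((0 : Fin n → ℂ), t) = t • ((0 : Fin n → ℂ), (1:ℂ)) := by simp
      show f (e (0, t)) = f (t • v)
      rw [this, map_smul, hev])
    have key : Ideal.span {mk f hf} = Ideal.map ((pullEquiv e).symm : _ →+* _)
        (Ideal.span {mk _ (hf.comp (e : ((Fin n → ℂ) × ℂ) →L[ℂ] (Fin (n+1) → ℂ)))}) := ?_
    · exact isNoetherianRing_of_ringEquiv _ (Ideal.quotientEquiv _ _ (pullEquiv e).symm key)
    rw [Ideal.map_span, Set.image_singleton]
    congr 2
    show _ = (pullEquiv e).symm (pullEquiv e (mk f hf))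
    rw [RingEquiv.symm_apply_apply]

theorem hol_noeth' (E : Type*) [NormedAddCommGroup E] [NormedSpace ℂ E] [FiniteDimensional ℂ E] :
    IsNoetherianRing (Hol E) := by
  have e : E ≃L[ℂ] (Fin (Module.finrank ℂ E) → ℂ) := ContinuousLinearEquiv.ofFinrankEq (by simp)
  have := hol_noeth (Module.finrank ℂ E)
  exact isNoetherianRing_of_ringEquiv _ (pullEquiv e)
end Arc
set_option linter.unusedSectionVars false
namespace Arc
open Filter Topology Metric

variable {E : Type*} [NormedAddCommGroup E] [NormedSpace ℂ E]
variable {F : Type*} [NormedAddCommGroup F] [NormedSpace ℂ F]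

lemma holAt_lin (L : E →L[ℂ] ℂ) : HolAt L := Eventually.of_forall fun _ => L.differentiableAt

/-- germ of a linear form -/
noncomputable def lin (L : E →L[ℂ] ℂ) : Hol E := mk L (holAt_lin L)

/-- The maximal ideal is generated by linear forms. -/
def MaxLin (E : Type*) [NormedAddCommGroup E] [NormedSpace ℂ E] : Prop :=
  ∀ φ : Hol E, val E φ = 0 → φ ∈ Ideal.span (Set.range (lin (E := E)))

lemma pull_span (L : F →L[ℂ] E) {φ : Hol E} (h : φ ∈ Ideal.span (Set.range (lin (E := E)))) :
    pull L φ ∈ Ideal.span (Set.range (lin (E := F))) := by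
  have := Ideal.mem_map_of_mem (pull L) h
  rw [Ideal.map_span] at this
  refine Ideal.span_mono ?_ this
  rintro _ ⟨_, ⟨l, rfl⟩, rfl⟩
  exact ⟨l.comp L, rfl⟩

lemma maxLin_prod (h : MaxLin F) : MaxLin (F × ℂ) := by
  intro φ hφ
  obtain ⟨f, hf, rfl⟩ := mk_surj φ
  rw [val_mk] at hφ
  obtain ⟨R, hR, hd⟩ := hf.diffOn
  rw [show (0 : F × ℂ) = (0, 0) from rfl, ← ball_prod_same] at hd
  have hQ : HolAt (Q1 f) := holAt_of_diffOn (by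
    rw [ball_prod_same]; exact ball_mem_nhds _ hR) (Q1_diff isOpen_ball hR hd)
  have hf0 : HolAt (fun y : F => f (y, 0)) := hf.comp (ContinuousLinearMap.inl ℂ F ℂ)
  have e : mk f hf = pull (ContinuousLinearMap.fst ℂ F ℂ) (mk _ hf0)
      + lin (ContinuousLinearMap.snd ℂ F ℂ) * mk _ hQ := by
    rw [pull_mk, lin, mk_mul, mk_add, mk_eq]
    exact Eventually.of_forall (fun p => Q1_eq f p)
  rw [e]
  refine add_mem (pull_span _ (h _ ?_)) (Ideal.mul_mem_right _ _ (Ideal.subset_span ⟨_, rfl⟩))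
  rw [val_mk]; exact hφ

lemma maxLin_equiv (e : E ≃L[ℂ] F) (h : MaxLin F) : MaxLin E := by
  intro φ hφ
  obtain ⟨g, rfl⟩ := (pullEquiv e).surjective φ
  refine pull_span (e : E →L[ℂ] F) (h g ?_)
  obtain ⟨f, hf, rfl⟩ := mk_surj g
  have : f (e 0) = 0 := hφ
  rw [val_mk]; simpa using this

lemma maxLin_fin (n : ℕ) : MaxLin (Fin n → ℂ) := by
  induction n with
  | zero =>
    intro φ hφ
    obtain ⟨f, hf, rfl⟩ := mk_surj φ
    have : mk f hf = 0 := by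
      rw [mk_zero, mk_eq]
      refine Eventually.of_forall (fun x => ?_)
      rw [Subsingleton.elim x 0]; exact hφ
    rw [this]; exact Ideal.zero_mem _
  | succ n ih =>
    have e0 : (Fin (n+1) → ℂ) ≃L[ℂ] ((Fin n → ℂ) × ℂ) :=
      ContinuousLinearEquiv.ofFinrankEq (by simp)
    exact maxLin_equiv e0 (maxLin_prod ih)

lemma maxLin [FiniteDimensional ℂ E] : MaxLin E := by
  have e : E ≃L[ℂ] (Fin (Module.finrank ℂ E) → ℂ) := ContinuousLinearEquiv.ofFinrankEq (by simp)
  exact maxLin_equiv e (maxLin_fin _)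

lemma HolAt.dir {f : E → ℂ} (hf : HolAt f) (v : E) : HolAt (fun x => fderiv ℂ f x v) := by
  obtain ⟨R, hR, hd⟩ := hf.diffOn
  exact holAt_of_diffOn (ball_mem_nhds _ hR) (diff_dir isOpen_ball hd v)

/-- directional derivative of germs -/
noncomputable def dd (v : E) (g : Hol E) : Hol E :=
  mk _ ((mk_surj g).choose_spec.choose.dir v)

lemma dd_mk (v : E) {f : E → ℂ} (hf : HolAt f) : dd v (mk f hf) = mk _ (hf.dir v) := by
  rw [dd, mk_eq]
  have h := (mk_surj (mk f hf)).choose_spec.choose_spec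
  rw [mk_eq] at h
  filter_upwards [h.eventuallyEq_nhds] with x hx
  rw [hx.fderiv_eq]

lemma dd_add (v : E) (a b : Hol E) : dd v (a + b) = dd v a + dd v b := by
  obtain ⟨f, hf, rfl⟩ := mk_surj a
  obtain ⟨g, hg, rfl⟩ := mk_surj b
  rw [mk_add, dd_mk, dd_mk, dd_mk, mk_add, mk_eq]
  filter_upwards [hf, hg] with x h1 h2
  rw [fderiv_add h1 h2]; rfl

lemma dd_mul (v : E) (a b : Hol E) : dd v (a * b) = a * dd v b + b * dd v a := by
  obtain ⟨f, hf, rfl⟩ := mk_surj a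
  obtain ⟨g, hg, rfl⟩ := mk_surj b
  rw [mk_mul, dd_mk, dd_mk, dd_mk, mk_mul, mk_mul, mk_add, mk_eq]
  filter_upwards [hf, hg] with x h1 h2
  rw [fderiv_mul h1 h2]; rfl

lemma dd_lin (v : E) (L : E →L[ℂ] ℂ) : dd v (lin L) = algebraMap ℂ (Hol E) (L v) := by
  rw [lin, dd_mk, algMap, mk_eq]
  refine Eventually.of_forall (fun x => ?_)
  simp

lemma dd_const (v : E) (c : ℂ) : dd v (algebraMap ℂ (Hol E) c) = 0 := by
  rw [algMap, dd_mk, mk_zero, mk_eq]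
  refine Eventually.of_forall (fun x => ?_)
  simp

open PowerSeries in
lemma arc_local (T : Hol E →ₐ[ℂ] PowerSeries ℂ) {φ : Hol E} (h : val E φ = 0) : X ∣ T φ := by
  rw [X_dvd_iff]
  by_contra hc
  set c := constantCoeff (T φ) with hcdef
  have hu : IsUnit (φ - algebraMap ℂ (Hol E) c) := by
    rw [isUnit_iff, map_sub, h, algMap, val_mk]; simpa using hc
  have h2 := ((hu.map T).map (constantCoeff (R := ℂ))).ne_zero
  apply h2
  rw [map_sub, map_sub, ← hcdef, AlgHom.commutes]
  simp [PowerSeries.algebraMap_apply]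

open PowerSeries in
/-- chain rule for arcs -/
lemma arc_chain {ι : Type*} [Fintype ι] [DecidableEq ι] (T : Hol (ι → ℂ) →ₐ[ℂ] PowerSeries ℂ) (φ : Hol (ι → ℂ)) :
    derivative ℂ (T φ) = ∑ i, T (dd (Pi.single i 1) φ) *
      derivative ℂ (T (lin (ContinuousLinearMap.proj i))) := by
  let Δ : Hol (ι → ℂ) → PowerSeries ℂ := fun φ => derivative ℂ (T φ) -
    ∑ i, T (dd (Pi.single i 1) φ) * derivative ℂ (T (lin (ContinuousLinearMap.proj i)))
  have hadd : ∀ a b, Δ (a + b) = Δ a + Δ b := by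
    intro a b
    simp only [Δ, dd_add, map_add, add_mul, Finset.sum_add_distrib]
    ring
  have hmul : ∀ a b, Δ (a * b) = T a * Δ b + T b * Δ a := by
    intro a b
    simp only [Δ, dd_mul, map_add, map_mul, add_mul, Finset.sum_add_distrib, Derivation.leibniz,
      smul_eq_mul, mul_sub, Finset.mul_sum, mul_assoc]
    ring
  have hconst : ∀ c, Δ (algebraMap ℂ _ c) = 0 := by
    intro c
    simp only [Δ, dd_const, map_zero, zero_mul, Finset.sum_const_zero, sub_zero, AlgHom.commutes]
    exact Derivation.map_algebraMap _ c
  have hlin : ∀ L, Δ (lin L) = 0 := by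
    intro L
    have hL : lin L = ∑ i, L (Pi.single i 1) • lin (ContinuousLinearMap.proj (R := ℂ)
        (φ := fun _ : ι => ℂ) i) := by
      have key : ∀ s : Finset ι, ∑ i ∈ s, L (Pi.single i 1) • lin (ContinuousLinearMap.proj (R := ℂ)
        (φ := fun _ : ι => ℂ) i) = lin (∑ i ∈ s, L (Pi.single i 1) • (ContinuousLinearMap.proj (R := ℂ)
        (φ := fun _ : ι => ℂ) i)) := by
        intro s
        induction s using Finset.induction_on with
        | empty => simp; rfl
        | insert i s hi ih =>
          rw [Finset.sum_insert hi, Finset.sum_insert hi, ih]; rfl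
      rw [key]
      congr 1
      refine ContinuousLinearMap.ext (fun x => ?_)
      conv_lhs => rw [pi_eq_sum_univ' x]
      simp [mul_comm]
    simp only [Δ, dd_lin, AlgHom.commutes]
    rw [hL]
    simp only [map_sum, map_smul]
    rw [sub_eq_zero]
    refine Finset.sum_congr rfl (fun i _ => ?_)
    rw [Derivation.map_smul, Algebra.smul_def]
  have hk : ∀ k : ℕ, ∀ φ, X ^ k ∣ Δ φ := by
    intro k
    induction k with
    | zero => intro φ; simp
    | succ k ih =>
      intro φ
      have hspan : ∀ ψ ∈ Ideal.span (Set.range (lin (E := ι → ℂ))), X ^ (k+1) ∣ Δ ψ := by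
        intro ψ hψ
        induction hψ using Submodule.span_induction with
        | mem x h => obtain ⟨L, rfl⟩ := h; rw [hlin]; exact dvd_zero _
        | zero =>
          have := hconst 0
          rw [map_zero] at this
          rw [this]; exact dvd_zero _
        | add x y _ _ h1 h2 => rw [hadd]; exact dvd_add h1 h2
        | smul a x hx h1 =>
          rw [smul_eq_mul, hmul]
          refine dvd_add (h1.mul_left _) ?_
          rw [pow_succ']
          refine mul_dvd_mul (arc_local T ?_) (ih a)
          refine (Ideal.span_le.2 ?_ hx : x ∈ RingHom.ker (val (ι → ℂ)))
          rintro _ ⟨L, rfl⟩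
          rw [SetLike.mem_coe, RingHom.mem_ker, lin, val_mk]; simp
      have h1 : Δ φ = Δ (φ - algebraMap ℂ _ (val _ φ)) := by
        have := hadd (φ - algebraMap ℂ _ (val _ φ)) (algebraMap ℂ _ (val _ φ))
        rw [hconst, add_zero, sub_add_cancel] at this
        exact this
      rw [h1]
      apply hspan
      apply maxLin
      rw [map_sub, algMap, val_mk, sub_self]
  have h0 : Δ φ = 0 := by
    ext m
    rw [map_zero]
    exact X_pow_dvd_iff.1 (hk (m+1) φ) m (Nat.lt_succ_self m)
  exact sub_eq_zero.1 h0

open PowerSeries in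
lemma ps_contra {h : PowerSeries ℂ} (h0 : h ≠ 0) (hX : X ∣ h) (hd : X * h ∣ derivative ℂ h) :
    False := by
  obtain ⟨k, hk, hlt⟩ : ∃ k, coeff k h ≠ 0 ∧ ∀ j < k, coeff j h = 0 := by
    have hex : ∃ k, coeff k h ≠ 0 := by
      by_contra hc
      push Not at hc
      exact h0 (PowerSeries.ext (by simpa using hc))
    exact ⟨Nat.find hex, Nat.find_spec hex, fun j hj => by simpa using Nat.find_min hex hj⟩
  rcases k with _ | k
  · apply hk
    rw [coeff_zero_eq_constantCoeff]
    exact X_dvd_iff.1 hX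
  · have h1 : X ^ (k+1) ∣ h := X_pow_dvd_iff.2 (fun m hm => hlt m hm)
    have h2 : X ^ (k+1) ∣ derivative ℂ h := (h1.mul_left X).trans hd
    have h3 := X_pow_dvd_iff.1 h2 k (Nat.lt_succ_self k)
    rw [PowerSeries.coeff_derivative] at h3
    have : ((k:ℂ) + 1) ≠ 0 := by exact_mod_cast Nat.succ_ne_zero k
    exact (mul_ne_zero hk this) h3

/-- projection to the first half of the coordinates -/
noncomputable def pr (n : ℕ) : (Fin n ⊕ Fin n → ℂ) →L[ℂ] (Fin n → ℂ) :=
  ContinuousLinearMap.pi (fun i => ContinuousLinearMap.proj (Sum.inl i))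

open PowerSeries in
lemma pow_mem {n : ℕ} {f : (Fin n → ℂ) → ℂ} (hf : HolAt f) (hf0 : f 0 = 0) :
    ∃ k, (pull (pr n) (mk f hf)) ^ k ∈ Ideal.span (Set.range fun i : Fin n =>
      pull (pr n) (mk f hf) * lin (ContinuousLinearMap.proj (Sum.inr i))
        - pull (pr n) (dd (Pi.single i 1) (mk f hf))) := by
  by_contra hc
  push Not at hc
  have := hol_noeth' (Fin n ⊕ Fin n → ℂ)
  obtain ⟨T, hT, hTf⟩ := exists_arc hol_res _ (pull (pr n) (mk f hf)) (by
    rw [mem_max, pull_mk, val_mk]; simpa using hf0) hc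
  have hch := arc_chain T (pull (pr n) (mk f hf))
  rw [Fintype.sum_sum_type] at hch
  have hr : ∀ i : Fin n, dd (Pi.single (Sum.inr i) 1) (pull (pr n) (mk f hf)) = 0 := by
    intro i
    rw [pull_mk, dd_mk, mk_zero, mk_eq]
    filter_upwards [(tend0 (pr n)).eventually hf] with x hx
    rw [show (fun x => f (pr n x)) = f ∘ (pr n) from rfl, fderiv_comp x hx (pr n).differentiableAt]
    simp only [ContinuousLinearMap.fderiv, ContinuousLinearMap.comp_apply]
    rw [show pr n (Pi.single (Sum.inr i) 1) = 0 by ext j; simp [pr], map_zero]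
  have hl : ∀ i : Fin n, dd (Pi.single (Sum.inl i) 1) (pull (pr n) (mk f hf))
      = pull (pr n) (dd (Pi.single i 1) (mk f hf)) := by
    intro i
    rw [pull_mk, dd_mk, dd_mk, pull_mk, mk_eq]
    filter_upwards [(tend0 (pr n)).eventually hf] with x hx
    rw [show (fun x => f (pr n x)) = f ∘ (pr n) from rfl, fderiv_comp x hx (pr n).differentiableAt]
    simp only [ContinuousLinearMap.fderiv, ContinuousLinearMap.comp_apply]
    rw [show pr n (Pi.single (Sum.inl i) 1) = Pi.single i 1 by ext j; simp [pr, Pi.single_apply]]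
  have hTi : ∀ i : Fin n, T (pull (pr n) (dd (Pi.single i 1) (mk f hf)))
      = T (pull (pr n) (mk f hf)) * T (lin (ContinuousLinearMap.proj (Sum.inr i))) := by
    intro i
    have := hT _ (Ideal.subset_span ⟨i, rfl⟩)
    rw [map_sub, map_mul, sub_eq_zero] at this
    exact this.symm
  refine ps_contra hTf (arc_local T ?_) ?_
  · rw [pull_mk, val_mk]; simpa using hf0
  · rw [hch]
    simp only [hr, hl, hTi, map_zero, zero_mul, Finset.sum_const_zero, add_zero]
    refine Finset.dvd_sum (fun i _ => Dvd.dvd.mul_right ?_ _)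
    rw [mul_comm]
    refine mul_dvd_mul dvd_rfl (arc_local T ?_)
    rw [lin, val_mk]; simp

/-- The Lojasiewicz-type inequality, complex version. -/
theorem loj_complex {n : ℕ} {f : (Fin n → ℂ) → ℂ} (hf : HolAt f) (hf0 : f 0 = 0) :
    ∃ ε > 0, ∀ x ∈ ball (0 : Fin n → ℂ) ε, f x = 0 ∨
      ∃ i, ε * ‖f x‖ ≤ ‖fderiv ℂ f x (Pi.single i 1)‖ := by
  obtain ⟨k, hk⟩ := pow_mem hf hf0
  rw [Ideal.mem_span_range_iff_exists_fun] at hk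
  obtain ⟨c, hc⟩ := hk
  choose g hg hgc using fun i => mk_surj (c i)
  have hs : ∀ s : Finset (Fin n), ((∑ i ∈ s, c i * (pull (pr n) (mk f hf) *
      lin (ContinuousLinearMap.proj (Sum.inr i)) - pull (pr n) (dd (Pi.single i 1) (mk f hf)))
      : Hol _) : Germ (𝓝 (0 : Fin n ⊕ Fin n → ℂ)) ℂ) =
      ((fun p => ∑ i ∈ s, g i p * (f (pr n p) * p (Sum.inr i)
        - fderiv ℂ f (pr n p) (Pi.single i 1)) : (Fin n ⊕ Fin n → ℂ) → ℂ) :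
        Germ (𝓝 (0 : Fin n ⊕ Fin n → ℂ)) ℂ) := by
    intro s
    induction s using Finset.induction_on with
    | empty => simp; rfl
    | insert i s hi ih =>
      simp_rw [Finset.sum_insert hi]
      rw [Subring.coe_add, ih, hgc i, dd_mk]; rfl
  have h1 := congrArg Subtype.val hc
  rw [hs] at h1
  have h2 : ∀ᶠ p in 𝓝 (0 : Fin n ⊕ Fin n → ℂ), ∑ i, g i p * (f (pr n p) * p (Sum.inr i)
        - fderiv ℂ f (pr n p) (Pi.single i 1)) = f (pr n p) ^ k := Germ.coe_eq.1 h1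
  obtain ⟨ε, hε, h3⟩ := Metric.mem_nhds_iff.1 h2
  refine ⟨ε, hε, fun x hx => ?_⟩
  by_contra hcon
  push Not at hcon
  obtain ⟨hne, hlt⟩ := hcon
  have hpos : 0 < ‖f x‖ := norm_pos_iff.2 hne
  let p : Fin n ⊕ Fin n → ℂ := Sum.elim x (fun i => fderiv ℂ f x (Pi.single i 1) / f x)
  have hprp : pr n p = x := by ext i; simp [pr, p]
  have hp : p ∈ ball (0 : Fin n ⊕ Fin n → ℂ) ε := by
    rw [mem_ball, dist_zero_right] at *
    rw [pi_norm_lt_iff hε] at *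
    rintro (i | i)
    · exact hx i
    · simp only [p, Sum.elim_inr, norm_div]
      rw [div_lt_iff₀ hpos]
      exact hlt i
  have h4 : ∑ i, g i p * (f (pr n p) * p (Sum.inr i)
        - fderiv ℂ f (pr n p) (Pi.single i 1)) = f (pr n p) ^ k := h3 hp
  rw [hprp, Finset.sum_eq_zero] at h4
  · exact pow_ne_zero k hne h4.symm
  · intro i _
    simp only [p, Sum.elim_inr]
    rw [mul_div_cancel₀ _ hne, sub_self, mul_zero]
end Arc
set_option linter.unusedSectionVars false
namespace Arc
open Filter Topology Metric

/-- complex points from real points -/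
noncomputable def cx {n : ℕ} (x : EuclideanSpace ℝ (Fin n)) : Fin n → ℂ := fun i => (x i : ℂ)

lemma cx_cont {n : ℕ} : Continuous (cx (n := n)) := by
  unfold cx
  fun_prop

lemma complexify {n : ℕ} {f : EuclideanSpace ℝ (Fin n) → ℝ} (hf : AnalyticAt ℝ f 0) :
    ∃ G : (Fin n → ℂ) → ℂ, HolAt G ∧ ∀ᶠ x in 𝓝 0, G (cx x) = f x := by
  obtain ⟨p, hp⟩ := hf
  obtain ⟨r, hr0, hr⟩ : ∃ r : NNReal, 0 < r ∧ (r : ENNReal) < p.radius := by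
    obtain ⟨r, h1, h2⟩ := ENNReal.lt_iff_exists_nnreal_btwn.1 hp.radius_pos
    exact ⟨r, by exact_mod_cast h1, h2⟩
  obtain ⟨C, hC, hpC⟩ := p.norm_mul_pow_le_of_lt_radius hr
  let e : Fin n → EuclideanSpace ℝ (Fin n) := fun i => EuclideanSpace.single i 1
  let P : ℕ → (Fin n → ℂ) → ℂ := fun k z =>
    ∑ s : Fin k → Fin n, ((p k (fun j => e (s j)) : ℝ) : ℂ) * ∏ j, z (s j)
  refine ⟨fun z => ∑' k, P k z, ?_, ?_⟩
  · set ρ : ℝ := r / (2 * (n + 1)) with hρ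
    have hr0' : (0:ℝ) < r := hr0
    have hρ0 : 0 < ρ := by positivity
    have hd : ∀ k, Differentiable ℂ (P k) := by
      intro k
      simp only [P]
      fun_prop
    have hb : ∀ k, ∀ z ∈ ball (0 : Fin n → ℂ) ρ, ‖P k z‖ ≤ C * (1/2) ^ k := by
      intro k z hz
      rw [mem_ball, dist_zero_right] at hz
      have hterm : ∀ s ∈ (Finset.univ : Finset (Fin k → Fin n)),
          ‖((p k (fun j => e (s j)) : ℝ) : ℂ) * ∏ j, z (s j)‖ ≤ ‖p k‖ * ρ ^ k := by
        intro s _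
        rw [norm_mul, Complex.norm_real, norm_prod]
        have h1 : ‖p k (fun j => e (s j))‖ ≤ ‖p k‖ := by
          have := (p k).le_opNorm (fun j => e (s j))
          simpa [e] using this
        have h2 : ∏ j, ‖z (s j)‖ ≤ ρ ^ k := by
          calc ∏ j, ‖z (s j)‖ ≤ ∏ j : Fin k, ρ :=
                Finset.prod_le_prod (fun _ _ => norm_nonneg _)
                  (fun j _ => (norm_le_pi_norm z (s j)).trans hz.le)
            _ = ρ ^ k := by simp
        gcongr
      have h3 := norm_sum_le_of_le _ hterm
      refine h3.trans ?_
      rw [Finset.sum_const, nsmul_eq_mul, Finset.card_univ, Fintype.card_fun, Fintype.card_fin,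
        Fintype.card_fin]
      push_cast
      have hnρ : n * ρ ≤ r / 2 := by
        rw [hρ, show (n:ℝ) * (r / (2 * (n + 1))) = (r / 2) * (n / (n + 1)) by field_simp]
        have : (n / (n + 1) : ℝ) ≤ 1 := by rw [div_le_one (by positivity)]; linarith
        nlinarith
      calc (n:ℝ) ^ k * (‖p k‖ * ρ ^ k) = ‖p k‖ * (n * ρ) ^ k := by rw [mul_pow]; ring
        _ ≤ ‖p k‖ * (r / 2) ^ k := by gcongr
        _ = (‖p k‖ * r ^ k) * (1/2) ^ k := by rw [div_eq_mul_one_div (r:ℝ), mul_pow]; ring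
        _ ≤ C * (1/2) ^ k := by gcongr; exact hpC k
    filter_upwards [ball_mem_nhds (0 : Fin n → ℂ) hρ0] with z hz
    obtain ⟨σ, hσ, hσb⟩ := Metric.isOpen_iff.1 isOpen_ball z hz
    exact diff_tsum (summable_geometric_two.mul_left C) hσ (fun k => (hd k).differentiableOn)
      (fun k y hy => hb k y (hσb hy))
  · filter_upwards [hp.eventually_hasSum] with x hx
    rw [zero_add] at hx
    have hPx : ∀ k, P k (cx x) = ((p k (fun _ => x) : ℝ) : ℂ) := by
      intro k
      have hxe : x = ∑ i, x i • e i := by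
        have := (EuclideanSpace.basisFun (Fin n) ℝ).sum_repr x
        simpa [e] using this.symm
      have h1 : p k (fun _ => x) = ∑ s : Fin k → Fin n, (∏ j, x (s j)) * p k (fun j => e (s j)) := by
        conv_lhs => rw [hxe]
        have := (p k).toMultilinearMap.map_sum (fun (_ : Fin k) (i : Fin n) => x i • e i)
        refine Eq.trans this (Finset.sum_congr rfl fun s _ => ?_)
        have h2 := (p k).toMultilinearMap.map_smul_univ (fun j => x (s j)) (fun j => e (s j))
        exact h2
      rw [h1]
      simp only [P, cx]
      push_cast
      exact Finset.sum_congr rfl fun s _ => mul_comm _ _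
    simp only [hPx]
    have := (Complex.hasSum_ofReal.2 hx).tsum_eq
    exact this

lemma loj_real {n : ℕ} {f : EuclideanSpace ℝ (Fin n) → ℝ} (hf : AnalyticAt ℝ f 0) (hf0 : f 0 = 0) :
    ∃ C > 0, ∀ᶠ x in 𝓝 0, |f x| ≤ C * ‖gradient f x‖ := by
  obtain ⟨G, hG, hGf⟩ := complexify hf
  have hcx0 : cx (0 : EuclideanSpace ℝ (Fin n)) = 0 := by ext i; simp [cx]
  have hG0 : G 0 = 0 := by
    have := hGf.self_of_nhds
    rwa [hcx0, hf0, Complex.ofReal_zero] at this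
  obtain ⟨ε, hε, hL⟩ := loj_complex hG hG0
  have hcxt : Tendsto (cx (n := n)) (𝓝 0) (𝓝 0) := by
    have := (cx_cont (n := n)).tendsto 0
    rwa [hcx0] at this
  refine ⟨1/ε, by positivity, ?_⟩
  filter_upwards [hcxt.eventually hG, hcxt.eventually (ball_mem_nhds _ hε),
    hGf.eventually_nhds, hf.eventually_analyticAt] with x hx1 hx2 hx3 hx4
  have hGx := hx3.self_of_nhds
  have hgn : ‖gradient f x‖ = ‖fderiv ℝ f x‖ := by
    simp [gradient]
  rcases hL _ hx2 with h | ⟨i, h⟩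
  · rw [hGx, Complex.ofReal_eq_zero] at h
    rw [h, abs_zero]; positivity
  · have hder : fderiv ℂ G (cx x) (Pi.single i 1) =
        ((fderiv ℝ f x (EuclideanSpace.single i 1) : ℝ) : ℂ) := by
      have h1 : HasDerivAt (fun t : ℝ => G (cx x + (t:ℂ) • Pi.single i 1))
          (fderiv ℂ G (cx x) (Pi.single i 1)) 0 := by
        have a1 : HasFDerivAt G (fderiv ℂ G (cx x)) (cx x + ((0:ℝ):ℂ) • Pi.single i 1) := by
          simpa using hx1.hasFDerivAt
        have a2 : HasDerivAt (fun z : ℂ => cx x + z • (Pi.single i 1 : Fin n → ℂ))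
            (Pi.single i 1) ((0:ℝ):ℂ) := by
          simpa using ((hasDerivAt_id ((0:ℝ):ℂ)).smul_const (Pi.single i 1 : Fin n → ℂ)).const_add (cx x)
        have a3 := a1.comp_hasDerivAt ((0:ℝ):ℂ) a2
        exact a3.comp_ofReal
      have h2 : HasDerivAt (fun t : ℝ => ((f (x + t • EuclideanSpace.single i 1) : ℝ) : ℂ))
          ((fderiv ℝ f x (EuclideanSpace.single i 1) : ℝ) : ℂ) 0 := by
        have a1 : HasFDerivAt f (fderiv ℝ f x) (x + (0:ℝ) • EuclideanSpace.single i (1:ℝ)) := by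
          simpa using hx4.differentiableAt.hasFDerivAt
        have a2 : HasDerivAt (fun t : ℝ => x + t • EuclideanSpace.single i (1:ℝ))
            (EuclideanSpace.single i 1) 0 := by
          simpa using ((hasDerivAt_id (0:ℝ)).smul_const (EuclideanSpace.single i (1:ℝ))).const_add x
        exact (a1.comp_hasDerivAt (0:ℝ) a2).ofReal_comp
      have hev : (fun t : ℝ => ((f (x + t • EuclideanSpace.single i 1) : ℝ) : ℂ)) =ᶠ[𝓝 0]
          (fun t : ℝ => G (cx x + (t:ℂ) • Pi.single i 1)) := by
        have ht : Tendsto (fun t : ℝ => x + t • EuclideanSpace.single i (1:ℝ)) (𝓝 0) (𝓝 x) := by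
          have : Continuous (fun t : ℝ => x + t • EuclideanSpace.single i (1:ℝ)) := by fun_prop
          simpa using this.tendsto 0
        filter_upwards [ht.eventually hx3] with t ht
        rw [← ht]
        congr 1
        ext j
        simp only [cx, PiLp.add_apply, PiLp.smul_apply, Pi.add_apply, Pi.smul_apply, smul_eq_mul,
          EuclideanSpace.single_apply, Pi.single_apply]
        split_ifs <;> simp
      exact (h1.congr_of_eventuallyEq hev).unique h2
    rw [hder, hGx, Complex.norm_real, Complex.norm_real] at h
    have h5 : ‖fderiv ℝ f x (EuclideanSpace.single i 1)‖ ≤ ‖fderiv ℝ f x‖ := by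
      simpa using (fderiv ℝ f x).le_opNorm (EuclideanSpace.single i (1:ℝ))
    rw [hgn, ← Real.norm_eq_abs, one_div, ← div_eq_inv_mul, le_div_iff₀ hε]
    linarith
end Arc
set_option linter.unusedSectionVars false
namespace Arc
open Filter Topology

lemma gradient_analytic {n : ℕ} {f : EuclideanSpace ℝ (Fin n) → ℝ} {x : EuclideanSpace ℝ (Fin n)}
    (hf : AnalyticAt ℝ f x) : AnalyticAt ℝ (gradient f) x := by
  have h := hf.fderiv
  exact ((InnerProductSpace.toDual ℝ (EuclideanSpace ℝ (Fin n))).symm.toContinuousLinearEquiv.toContinuousLinearMap.analyticAt (fderiv ℝ f x)).comp h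

lemma norm_gradient {n : ℕ} {f : EuclideanSpace ℝ (Fin n) → ℝ} (x : EuclideanSpace ℝ (Fin n)) :
    ‖gradient f x‖ = ‖fderiv ℝ f x‖ := by
  simp [gradient]

lemma grad_diff_bound {n : ℕ} (f g h : EuclideanSpace ℝ (Fin n) → ℝ) (r : ℕ)
    (hf : AnalyticAt ℝ f 0) (hh : AnalyticAt ℝ h 0) (hf0 : f 0 = 0)
    (hmem : ∀ᶠ x in 𝓝 0, g x - f x = h x * f x ^ (r + 2)) :
    ∃ C > 0, ∀ᶠ x in 𝓝 0, |f x| ≤ C * ‖gradient f x‖ ∧ |g x - f x| ≤ C * ‖gradient f x‖ ^ (r + 2) ∧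
      ‖gradient (fun y => g y - f y) x‖ ≤ (1/6) * ‖gradient f x‖ := by
  obtain ⟨C, hC, hfC⟩ := loj_real hf hf0
  set M : ℝ := |h 0| + ‖gradient h 0‖ + 1 with hM
  have hM0 : 0 < M := by positivity
  have h1 : ∀ᶠ x in 𝓝 0, |h x| ≤ M := by
    have : ContinuousAt (fun x => |h x|) 0 := hh.continuousAt.abs
    exact this.eventually_le_const (by rw [hM]; linarith [norm_nonneg (gradient h 0)])
  have h2 : ∀ᶠ x in 𝓝 0, ‖gradient h x‖ ≤ M := by
    have : ContinuousAt (fun x => ‖gradient h x‖) 0 := (gradient_analytic hh).continuousAt.norm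
    exact this.eventually_le_const (by rw [hM]; linarith [abs_nonneg (h 0)])
  have hfc : ContinuousAt (fun x => |f x|) 0 := hf.continuousAt.abs
  have h3 : ∀ᶠ x in 𝓝 0, |f x| ≤ 1 := hfc.eventually_le_const (by simp [hf0])
  set K : ℝ := M * (r + 2) + M * C
  have hK : 0 < K := by positivity
  have h4 : ∀ᶠ x in 𝓝 0, |f x| ≤ 1 / (6 * K) := hfc.eventually_le_const (by simp [hf0]; positivity)
  refine ⟨C + M * C ^ (r + 2), by positivity, ?_⟩
  filter_upwards [hfC, h1, h2, h3, h4, hmem.eventually_nhds, hf.eventually_analyticAt,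
    hh.eventually_analyticAt] with x a1 a2 a3 a4 a5 a6 a7 a8
  have hG := norm_nonneg (gradient f x)
  refine ⟨a1.trans ?_, ?_, ?_⟩
  · gcongr; linarith [show 0 < M * C ^ (r + 2) by positivity]
  · rw [a6.self_of_nhds, abs_mul, abs_pow]
    calc |h x| * |f x| ^ (r + 2) ≤ M * (C * ‖gradient f x‖) ^ (r + 2) := by gcongr
      _ = (M * C ^ (r+2)) * ‖gradient f x‖ ^ (r + 2) := by rw [mul_pow]; ring
      _ ≤ _ := by gcongr; linarith
  · have e1 : (fun y => g y - f y) =ᶠ[𝓝 x] fun y => h y * f y ^ (r + 2) := a6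
    have hd : HasFDerivAt (fun y => h y * f y ^ (r + 2)) _ x :=
      a8.differentiableAt.hasFDerivAt.mul (a7.differentiableAt.hasFDerivAt.pow (r + 2))
    rw [norm_gradient, e1.fderiv_eq, hd.fderiv]
    refine (norm_add_le _ _).trans ?_
    rw [norm_smul, norm_smul _ (fderiv ℝ f x), norm_smul _ (fderiv ℝ h x), ← norm_gradient, ← norm_gradient]
    simp only [norm_pow, Real.norm_eq_abs]
    have e2 : |f x| ^ (r + 1) ≤ |f x| := by
      rw [pow_succ]; exact mul_le_of_le_one_left (abs_nonneg _) (pow_le_one₀ (abs_nonneg _) a4)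
    have e3 : |f x| ^ (r + 2) ≤ |f x| * (C * ‖gradient f x‖) := by
      rw [pow_succ]; gcongr
    have e4 : ‖((r + 2) • f x ^ (r + 2 - 1) : ℝ)‖ ≤ (r + 2) * |f x| := by
      simp only [nsmul_eq_mul, Real.norm_eq_abs, abs_mul, abs_pow]
      rw [show r + 2 - 1 = r + 1 by omega, Nat.abs_cast]; push_cast; gcongr
    simp only [Real.norm_eq_abs] at e4
    calc _ ≤ M * (((r + 2) * |f x|) * ‖gradient f x‖) + (|f x| * (C * ‖gradient f x‖)) * M := by
          gcongr
      _ = |f x| * (K * ‖gradient f x‖) := by simp only [K]; ring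
      _ ≤ 1 / (6 * K) * (K * ‖gradient f x‖) := by gcongr
      _ = _ := by field_simp

lemma grad_lip {n : ℕ} (f : EuclideanSpace ℝ (Fin n) → ℝ)
    (hf : AnalyticAt ℝ f 0) (hgrad : gradient f 0 = 0) :
    ∃ L > 0, ∀ᶠ x in 𝓝 0, ‖gradient f x‖ ≤ L * Metric.infDist x {y | gradient f y = 0} := by
  have hc : ContDiffAt ℝ 1 (gradient f) 0 := (gradient_analytic hf).contDiffAt
  obtain ⟨K, t, ht, hL⟩ := hc.exists_lipschitzOnWith
  obtain ⟨ρ, hρ, hb⟩ := Metric.mem_nhds_iff.1 ht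
  refine ⟨K + 1, by positivity, ?_⟩
  filter_upwards [Metric.ball_mem_nhds 0 (half_pos hρ)] with x hx
  have hx' : ‖x‖ < ρ / 2 := by simpa using hx
  have hxt : x ∈ t := hb (by simp; linarith)
  have key : ∀ y ∈ {y | gradient f y = 0}, ‖gradient f x‖ / (K + 1) ≤ dist x y := by
    intro y hy
    rw [div_le_iff₀ (by positivity)]
    have hK := K.2
    have main : ∀ z ∈ t, gradient f z = 0 → ‖gradient f x‖ ≤ dist x z * (K + 1) := by
      intro z hz hz0
      have := hL.dist_le_mul x hxt z hz
      rw [hz0, dist_zero_right] at this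
      nlinarith [dist_nonneg (x := x) (y := z)]
    by_cases hyb : ‖y‖ < ρ
    · exact main y (hb (by simpa using hyb)) hy
    · have := main 0 (hb (by simpa using hρ)) hgrad
      refine this.trans ?_
      have h5 : ‖y‖ - ‖x‖ ≤ dist x y := by
        rw [dist_comm, dist_eq_norm]; exact norm_sub_norm_le _ _
      rw [dist_zero_right]
      gcongr
      linarith
  have := (Metric.le_infDist (s := {y | gradient f y = 0}) ⟨0, hgrad⟩).2 (fun {y} hy => key y hy)
  rw [div_le_iff₀ (by positivity)] at this
  linarith
end Arc
/-- under the hypotheses of the Main Theorem, after shrinking `U`, there is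
`A' > 0` such that `‖X(ξ,x)‖ ≤ A'·dist(x,Z)^{r+1}` on `G = {|ξ| < δ} × U`; in particular
`X` is continuous on `G`. -/
theorem stmt8 {n : ℕ} (f g : EuclideanSpace ℝ (Fin n) → ℝ) (r : ℕ) (hr : 1 ≤ r)
    (hf : AnalyticAt ℝ f 0) (hg : AnalyticAt ℝ g 0) (hf0 : f 0 = 0) (hg0 : g 0 = 0)
    (hgrad : gradient f 0 = 0)
    (hmem : ∃ h : EuclideanSpace ℝ (Fin n) → ℝ, AnalyticAt ℝ h 0 ∧
      ∀ᶠ x in nhds 0, g x - f x = h x * f x ^ (r + 2)) :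
    ∃ δ > (2 : ℝ), ∃ U ∈ nhds (0 : EuclideanSpace ℝ (Fin n)), ∃ A' > (0 : ℝ),
      (∀ x ∈ U, ∀ ξ : ℝ, |ξ| < δ →
        ‖XF f g ξ x‖ ≤ A' * Metric.infDist x {y | gradient f y = 0} ^ (r + 1)) ∧
      ContinuousOn (fun p : ℝ × EuclideanSpace ℝ (Fin n) => XF f g p.1 p.2)
        {p : ℝ × EuclideanSpace ℝ (Fin n) | |p.1| < δ ∧ p.2 ∈ U} := by
  obtain ⟨h, hh, hm⟩ := hmem
  obtain ⟨C, hC, hb⟩ := Arc.grad_diff_bound f g h r hf hh hf0 hm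
  obtain ⟨L, hL, hl⟩ := Arc.grad_lip f hf hgrad
  have hgf : AnalyticAt ℝ (fun y => g y - f y) 0 := hg.sub hf
  obtain ⟨ρ, hρ, hU⟩ := Metric.eventually_nhds_iff_ball.1
    (hb.and (hl.and (hf.eventually_analyticAt.and hgf.eventually_analyticAt)))
  have lower : ∀ x ∈ Metric.ball (0 : EuclideanSpace ℝ (Fin n)) ρ, ∀ ξ : ℝ, |ξ| < 3 →
      (1/2) * ‖gradient f x‖ ≤ ‖gradF f g ξ x‖ := by
    intro x hx ξ hξ
    obtain ⟨⟨-, -, b⟩, -⟩ := hU x hx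
    have h1 : ‖gradient f x + ξ • gradient (fun y => g y - f y) x‖ ≤ ‖gradF f g ξ x‖ :=
      norm_snd_le (gradF f g ξ x)
    refine le_trans ?_ h1
    have h2 : ‖gradient f x‖ - ‖ξ • gradient (fun y => g y - f y) x‖ ≤
        ‖gradient f x + ξ • gradient (fun y => g y - f y) x‖ := norm_sub_le_norm_add _ _
    have h3 : ‖ξ • gradient (fun y => g y - f y) x‖ ≤ 3 * ((1/6) * ‖gradient f x‖) := by
      rw [norm_smul, Real.norm_eq_abs]; gcongr
    linarith
  have bound : ∀ x ∈ Metric.ball (0 : EuclideanSpace ℝ (Fin n)) ρ, ∀ ξ : ℝ, |ξ| < 3 →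
      ‖XF f g ξ x‖ ≤ 2 * C * ‖gradient f x‖ ^ (r + 1) := by
    intro x hx ξ hξ
    by_cases h0 : gradient f x = 0
    · simp [XF, h0]
    have hp : 0 < ‖gradient f x‖ := norm_pos_iff.2 h0
    have hlo := lower x hx ξ hξ
    have hq : 0 < ‖gradF f g ξ x‖ := by linarith
    obtain ⟨⟨-, b, -⟩, -⟩ := hU x hx
    rw [XF, if_neg h0, norm_smul, norm_div, norm_pow, norm_norm, Real.norm_eq_abs]
    calc |g x - f x| / ‖gradF f g ξ x‖ ^ 2 * ‖gradF f g ξ x‖ = |g x - f x| / ‖gradF f g ξ x‖ := by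
          field_simp
      _ ≤ (C * ‖gradient f x‖ ^ (r + 2)) / ((1/2) * ‖gradient f x‖) := by gcongr
      _ = 2 * C * ‖gradient f x‖ ^ (r + 1) := by
          rw [pow_succ _ (r + 1)]; field_simp
  refine ⟨3, by norm_num, Metric.ball 0 ρ, Metric.ball_mem_nhds _ hρ, 2 * C * L ^ (r + 1),
    by positivity, ?_, ?_⟩
  · intro x hx ξ hξ
    refine (bound x hx ξ hξ).trans ?_
    obtain ⟨-, b, -⟩ := hU x hx
    rw [mul_assoc (2 * C), ← mul_pow]
    gcongr
  · rintro ⟨ξ, x⟩ ⟨hξ, hx⟩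
    simp only at hξ hx
    obtain ⟨-, -, af, agf⟩ := hU x hx
    have cs : ContinuousAt (fun p : ℝ × EuclideanSpace ℝ (Fin n) => p.2) (ξ, x) :=
      continuousAt_snd
    have cg : ContinuousAt (fun p : ℝ × EuclideanSpace ℝ (Fin n) => gradient f p.2) (ξ, x) :=
      ContinuousAt.comp (g := gradient f) (f := Prod.snd) (Arc.gradient_analytic af).continuousAt cs
    by_cases h0 : gradient f x = 0
    · have hz : XF f g ξ x = 0 := by simp [XF, h0]
      show Filter.Tendsto _ _ (nhds (XF f g ξ x))
      rw [hz]
      have lim : Filter.Tendsto (fun p : ℝ × EuclideanSpace ℝ (Fin n) =>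
          2 * C * ‖gradient f p.2‖ ^ (r + 1)) (nhds (ξ, x)) (nhds 0) := by
        have : ContinuousAt (fun p : ℝ × EuclideanSpace ℝ (Fin n) =>
          2 * C * ‖gradient f p.2‖ ^ (r + 1)) (ξ, x) := (cg.norm.pow _).const_mul _
        have h2 := this.tendsto
        simpa [h0] using h2
      refine squeeze_zero_norm' ?_ (lim.mono_left nhdsWithin_le_nhds)
      filter_upwards [self_mem_nhdsWithin] with p hp
      exact bound p.2 hp.2 p.1 hp.1
    · apply ContinuousAt.continuousWithinAt
      have hq : 0 < ‖gradF f g ξ x‖ := by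
        have := lower x hx ξ hξ
        have hp : 0 < ‖gradient f x‖ := norm_pos_iff.2 h0
        linarith
      have cd : ContinuousAt (fun p : ℝ × EuclideanSpace ℝ (Fin n) => g p.2 - f p.2) (ξ, x) :=
        ContinuousAt.comp (g := fun y => g y - f y) (f := Prod.snd) agf.continuousAt cs
      have cdg : ContinuousAt (fun p : ℝ × EuclideanSpace ℝ (Fin n) =>
          gradient (fun y => g y - f y) p.2) (ξ, x) :=
        ContinuousAt.comp (g := gradient (fun y => g y - f y)) (f := Prod.snd)
          (Arc.gradient_analytic agf).continuousAt cs
      have cF : ContinuousAt (fun p : ℝ × EuclideanSpace ℝ (Fin n) => gradF f g p.1 p.2) (ξ, x) :=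
        cd.prodMk (cg.add (continuousAt_fst.smul cdg))
      have cX : ContinuousAt (fun p : ℝ × EuclideanSpace ℝ (Fin n) =>
          ((g p.2 - f p.2) / ‖gradF f g p.1 p.2‖ ^ 2) • gradF f g p.1 p.2) (ξ, x) :=
        (cd.div (cF.norm.pow 2) (pow_pos hq 2).ne').smul cF
      refine cX.congr ?_
      filter_upwards [cg.eventually_ne h0] with p hp
      rw [XF, if_neg hp]
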